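/- Let p > 3 be a prime, n a positive integer, G = A_n the alternating group, F a field of characteristic p, and M a finite-dimensional FG-module. Then for j = 1 and j = 2, (p-2)·dim H^j(G,M) ≤ dim M. -/

import Mathlib

section CohomologyBounds

open CategoryTheory Module groupCohomology

section Basics

variable {F G : Type} [Field F] [Group G]

/-- The dimension of the `n`-th cohomology of a representation. -/
noncomputable def hdim (n : ℕ) {M : Type} [AddCommGroup M] [Module F M]
    (ρ : Representation F G M) : ℕ :=
  finrank F (groupCohomology (Rep.of ρ) n)

/-- The dimension of the space of invariants of a representation. -/
noncomputable def idim {M : Type} [AddCommGroup M] [Module F M]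
    (ρ : Representation F G M) : ℕ :=
  finrank F ρ.invariants

theorem finite_groupCohomology [Finite G] (A : Rep.{0} F G) [FiniteDimensional F A.V] (n : ℕ) :
    FiniteDimensional F (groupCohomology A n) := by
  have h1 : FiniteDimensional F ((inhomogeneousCochains A).X n) :=
    inferInstanceAs (FiniteDimensional F ((Fin n → G) → A.V))
  have h2 : FiniteDimensional F (cocycles A n) :=
    Module.Finite.of_injective (iCocycles A n).hom
      ((ModuleCat.mono_iff_injective _).1 inferInstance)
  exact Module.Finite.of_surjective (groupCohomology.π A n).hom
    ((ModuleCat.epi_iff_surjective _).1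
      (inferInstanceAs (Epi ((inhomogeneousCochains A).homologyπ n))))

variable {M₁ M₂ M₃ : Type} [AddCommGroup M₁] [Module F M₁] [AddCommGroup M₂] [Module F M₂]
  [AddCommGroup M₃] [Module F M₃]
  {ρ₁ : Representation F G M₁} {ρ₂ : Representation F G M₂} {ρ₃ : Representation F G M₃}

theorem hdim_zero (ρ : Representation F G M₁) : hdim 0 ρ = idim ρ :=
  (H0Iso (Rep.of ρ)).toLinearEquiv.finrank_eq

theorem hdim_congr (e : ρ₁.Equiv ρ₂) (n : ℕ) : hdim n ρ₁ = hdim n ρ₂ :=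
  ((functor F G n).mapIso (Rep.mkIso e)).toLinearEquiv.finrank_eq

/-- A short exact sequence of representations. -/
structure IsSES (i : ρ₁.IntertwiningMap ρ₂) (q : ρ₂.IntertwiningMap ρ₃) : Prop where
  inj : Function.Injective i
  surj : Function.Surjective q
  exact : ∀ x, q x = 0 ↔ ∃ y, i y = x

variable {i : ρ₁.IntertwiningMap ρ₂} {q : ρ₂.IntertwiningMap ρ₃}

theorem IsSES.exists_shortExact (h : IsSES i q) :
    ∃ w, (ShortComplex.mk (Rep.ofHom i) (Rep.ofHom q) w).ShortExact := by
  have w : Rep.ofHom i ≫ Rep.ofHom q = 0 := by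
    ext x
    exact (h.exact _).2 ⟨x, rfl⟩
  have hm : Mono (Rep.ofHom i) := (Rep.mono_iff_injective _).2 h.inj
  have he : Epi (Rep.ofHom q) := (Rep.epi_iff_surjective _).2 h.surj
  refine ⟨w, ShortComplex.ShortExact.mk' ?_ hm he⟩
  rw [← ShortComplex.exact_map_iff_of_faithful _ (forget₂ (Rep F G) (ModuleCat F)),
    ShortComplex.moduleCat_exact_iff]
  intro x hx
  exact (h.exact x).1 hx

theorem finrank_of_exact {A B C : ModuleCat.{0} F} {f : A ⟶ B} {g : B ⟶ C} {w : f ≫ g = 0}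
    (h : (ShortComplex.mk f g w).Exact) (hB : FiniteDimensional F B) :
    finrank F B = finrank F (LinearMap.range f.hom) + finrank F (LinearMap.range g.hom) := by
  have := h.moduleCat_range_eq_ker
  have h2 := LinearMap.finrank_range_add_finrank_ker g.hom
  simp only at this
  rw [this, add_comm]
  exact h2.symm

theorem IsSES.finrank_eq [FiniteDimensional F M₂] (h : IsSES i q) :
    finrank F M₂ = finrank F M₁ + finrank F M₃ := by
  have h1 := LinearMap.finrank_range_add_finrank_ker q.toLinearMap
  have h2 : LinearMap.ker q.toLinearMap = LinearMap.range i.toLinearMap := by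
    ext x; exact h.exact x
  rw [h2, LinearMap.range_eq_top.2 h.surj, finrank_top,
    LinearMap.finrank_range_of_inj h.inj] at h1
  omega

variable [Finite G] [FiniteDimensional F M₁] [FiniteDimensional F M₂] [FiniteDimensional F M₃]

theorem IsSES.hdim_le (h : IsSES i q) (n : ℕ) : hdim n ρ₂ ≤ hdim n ρ₁ + hdim n ρ₃ := by
  obtain ⟨w, hX⟩ := h.exists_shortExact
  have e := mapShortComplex₂_exact hX n
  have : FiniteDimensional F ((functor F G n).obj (Rep.of ρ₁)) := finite_groupCohomology _ n
  have : FiniteDimensional F ((functor F G n).obj (Rep.of ρ₃)) := finite_groupCohomology _ n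
  have e2 := finrank_of_exact e (finite_groupCohomology (Rep.of ρ₂) n)
  exact e2.le.trans (add_le_add
    (LinearMap.finrank_range_le ((functor F G n).map (Rep.ofHom i)).hom)
    (Submodule.finrank_le (LinearMap.range ((functor F G n).map (Rep.ofHom q)).hom)))

theorem IsSES.idim_le (h : IsSES i q) : idim ρ₂ ≤ idim ρ₁ + idim ρ₃ := by
  simpa only [hdim_zero] using h.hdim_le 0

omit [FiniteDimensional F M₁] [FiniteDimensional F M₃] in
theorem IsSES.hdim_two_eq (h : IsSES i q) (h1 : hdim 1 ρ₂ = 0) (h2 : hdim 2 ρ₂ = 0) :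
    hdim 2 ρ₁ = hdim 1 ρ₃ := by
  obtain ⟨w, hX⟩ := h.exists_shortExact
  have := finite_groupCohomology (Rep.of ρ₂) 1
  have := finite_groupCohomology (Rep.of ρ₂) 2
  have z1 : Limits.IsZero (groupCohomology (Rep.of ρ₂) 1) :=
    (ModuleCat.isZero_iff_subsingleton).2 (finrank_zero_iff.1 h1)
  have z2 : Limits.IsZero (groupCohomology (Rep.of ρ₂) 2) :=
    (ModuleCat.isZero_iff_subsingleton).2 (finrank_zero_iff.1 h2)
  have := isIso_δ_of_isZero hX 1 z1 z2
  exact (asIso (δ hX 1 2 rfl)).toLinearEquiv.finrank_eq.symm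

theorem IsSES.hdim_one_add (h : IsSES i q) (h1 : hdim 1 ρ₂ = 0) :
    hdim 1 ρ₁ + idim ρ₂ = idim ρ₃ + idim ρ₁ := by
  obtain ⟨w, hX⟩ := h.exists_shortExact
  have := finite_groupCohomology (Rep.of ρ₁) 0
  have := finite_groupCohomology (Rep.of ρ₂) 0
  have := finite_groupCohomology (Rep.of ρ₃) 0
  have := finite_groupCohomology (Rep.of ρ₁) 1
  have := finite_groupCohomology (Rep.of ρ₂) 1
  have z1 : Limits.IsZero (groupCohomology (Rep.of ρ₂) 1) :=
    (ModuleCat.isZero_iff_subsingleton).2 (finrank_zero_iff.1 h1)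
  have := epi_δ_of_isZero hX 0 z1
  have e3 := finrank_of_exact (mapShortComplex₃_exact hX (rfl : 0 + 1 = 1))
    (finite_groupCohomology (Rep.of ρ₃) 0)
  have e2 := finrank_of_exact (mapShortComplex₂_exact hX 0)
    (finite_groupCohomology (Rep.of ρ₂) 0)
  have hi : finrank F (LinearMap.range ((functor F G 0).map (Rep.ofHom i)).hom) =
      finrank F (groupCohomology (Rep.of ρ₁) 0) := by
    apply LinearMap.finrank_range_of_inj
    have := hX.mono_f
    exact (ModuleCat.mono_iff_injective _).1 (mono_map_0_of_mono (Rep.ofHom i))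
  have hd : finrank F (LinearMap.range (δ hX 0 1 rfl).hom) =
      finrank F (groupCohomology (Rep.of ρ₁) 1) := by
    rw [LinearMap.range_eq_top.2 ((ModuleCat.epi_iff_surjective _).1 this), finrank_top]
  simp only [← hdim_zero]
  unfold hdim
  change finrank F (groupCohomology (Rep.of ρ₃) 0) = finrank F (LinearMap.range
    ((functor F G 0).map (Rep.ofHom q)).hom) + finrank F (LinearMap.range (δ hX 0 1 rfl).hom) at e3
  change finrank F (groupCohomology (Rep.of ρ₂) 0) = finrank F (LinearMap.range
    ((functor F G 0).map (Rep.ofHom i)).hom) + finrank F (LinearMap.range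
    ((functor F G 0).map (Rep.ofHom q)).hom) at e2
  omega

end Basics

section Transfer

variable {F G : Type} [Field F] [Group G] {M : Type} [AddCommGroup M] [Module F M]

/-- The embedding of a representation into the representation coinduced from its restriction. -/
def toCoind (S : Subgroup G) (ρ : Representation F G M) :
    ρ.IntertwiningMap (Representation.coind S.subtype (ρ.comp S.subtype)) where
  toFun m := ⟨fun g => ρ g m, fun s g => by simp⟩
  map_add' x y := by ext; simp
  map_smul' c x := by ext; simp
  isIntertwining' g := by
    ext m x
    exact (LinearMap.congr_fun (map_mul ρ x g) m).symm

/-- The summand of the relative trace attached to a coset. -/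
noncomputable def traceTerm (S : Subgroup G) (ρ : Representation F G M) (P : M →ₗ[F] M)
    (hP : ∀ s ∈ S, ∀ m, P (ρ s m) = ρ s (P m))
    (f : Representation.coindV S.subtype (ρ.comp S.subtype)) : G ⧸ S → M :=
  Quotient.lift (fun g => ρ g (P (f.1 g⁻¹))) fun a b hab => by
    have hs : a⁻¹ * b ∈ S := QuotientGroup.leftRel_apply.1 hab
    have h := f.2 ⟨_, hs⟩ b⁻¹
    simp only [Subgroup.subtype_apply, MonoidHom.comp_apply] at h
    rw [show a⁻¹ * b * b⁻¹ = a⁻¹ by group] at h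
    simp only [h, hP _ hs]
    rw [← Module.End.mul_apply, ← map_mul, mul_inv_cancel_left]

/-- The relative trace. -/
noncomputable def fromCoind [Finite G] (S : Subgroup G) (ρ : Representation F G M) (P : M →ₗ[F] M)
    (hP : ∀ s ∈ S, ∀ m, P (ρ s m) = ρ s (P m)) :
    (Representation.coind S.subtype (ρ.comp S.subtype)).IntertwiningMap ρ where
  toFun f := ∑ᶠ x, traceTerm S ρ P hP f x
  map_add' a b := by
    rw [← finsum_add_distrib (Set.toFinite _) (Set.toFinite _)]
    refine finsum_congr fun x => ?_
    induction x using QuotientGroup.induction_on with | H g => ?_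
    simp [traceTerm]
  map_smul' c a := by
    rw [RingHom.id_apply, smul_finsum' _ (Set.toFinite _)]
    refine finsum_congr fun x => ?_
    induction x using QuotientGroup.induction_on with | H g => ?_
    simp [traceTerm]
  isIntertwining' h := by
    ext f
    change ∑ᶠ x, traceTerm S ρ P hP _ x = ρ h (∑ᶠ x, traceTerm S ρ P hP f x)
    have e : ρ h (∑ᶠ x, traceTerm S ρ P hP f x) = ∑ᶠ x, ρ h (traceTerm S ρ P hP f x) :=
      AddMonoidHom.map_finsum (ρ h).toAddMonoidHom (Set.toFinite _)
    rw [e, ← finsum_comp_equiv (f := fun x => ρ h (traceTerm S ρ P hP f x))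
      (MulAction.toPerm h⁻¹)]
    refine finsum_congr fun x => ?_
    induction x using QuotientGroup.induction_on with | H g => ?_
    change ρ g (P (f.1 (g⁻¹ * h))) = ρ h (ρ (h⁻¹ * g) (P (f.1 (h⁻¹ * g)⁻¹)))
    have e2 : ρ h (ρ (h⁻¹ * g) (P (f.1 (h⁻¹ * g)⁻¹))) = ρ g (P (f.1 (h⁻¹ * g)⁻¹)) := by
      rw [← Module.End.mul_apply, ← map_mul, mul_inv_cancel_left]
    rw [e2, mul_inv_rev, inv_inv]

variable [Finite G] [FiniteDimensional F M]

theorem hdim_le_of_trace (S : Subgroup G) (ρ : Representation F G M) (P : M →ₗ[F] M)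
    (hP : ∀ s ∈ S, ∀ m, P (ρ s m) = ρ s (P m))
    (hsum : ∀ m, ∑ᶠ x, traceTerm S ρ P hP (toCoind S ρ m) x = m) (n : ℕ) :
    hdim n ρ ≤ hdim n (ρ.comp S.subtype) := by
  have hr : Rep.ofHom (toCoind S ρ) ≫ Rep.ofHom (fromCoind S ρ P hP) = 𝟙 _ := by
    ext m
    exact hsum m
  have hr2 := congrArg ((functor F G n).map) hr
  rw [CategoryTheory.Functor.map_comp, CategoryTheory.Functor.map_id] at hr2
  have e := coindIso (Rep.of (ρ.comp S.subtype)) n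
  have hfin := finite_groupCohomology (Rep.of (ρ.comp S.subtype)) n
  have hinj : Function.Injective ((functor F G n).map (Rep.ofHom (toCoind S ρ))).hom :=
    Function.LeftInverse.injective
      (g := ((functor F G n).map (Rep.ofHom (fromCoind S ρ P hP))).hom) fun x =>
        ConcreteCategory.congr_hom hr2 x
  exact LinearMap.finrank_le_finrank_of_injective
    (f := e.toLinearEquiv.toLinearMap ∘ₗ ((functor F G n).map (Rep.ofHom (toCoind S ρ))).hom)
    (e.toLinearEquiv.injective.comp hinj)

theorem hdim_le_of_index (S : Subgroup G) (hS : (S.index : F) ≠ 0) (ρ : Representation F G M)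
    (n : ℕ) : hdim n ρ ≤ hdim n (ρ.comp S.subtype) := by
  refine hdim_le_of_trace S ρ ((S.index : F)⁻¹ • LinearMap.id) (by simp) (fun m => ?_) n
  have : ∀ x, traceTerm S ρ ((S.index : F)⁻¹ • LinearMap.id) (by simp) (toCoind S ρ m) x =
      (S.index : F)⁻¹ • m := by
    intro x
    induction x using QuotientGroup.induction_on with | H g => ?_
    change ρ g ((S.index : F)⁻¹ • (ρ g⁻¹ m)) = _
    rw [map_smul, ← Module.End.mul_apply, ← map_mul]
    simp
  cases nonempty_fintype (G ⧸ S)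
  rw [finsum_congr this, finsum_eq_sum_of_fintype]
  simp only [Finset.sum_const, Finset.card_univ, ← Nat.card_eq_fintype_card]
  rw [← Subgroup.index, ← Nat.cast_smul_eq_nsmul F, smul_smul, mul_inv_cancel₀ hS, one_smul]

theorem hdim_succ_eq_zero (ρ : Representation F G M) (P : M →ₗ[F] M)
    (hP : ∀ m, ∑ᶠ g : G, ρ g (P (ρ g⁻¹ m)) = m) (n : ℕ) : hdim (n + 1) ρ = 0 := by
  refine Nat.eq_zero_of_le_zero ((hdim_le_of_trace ⊥ ρ P (by simp) (fun m => ?_) (n + 1)).trans ?_)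
  · refine Eq.trans ?_ (hP m)
    rw [← finsum_comp_equiv (QuotientGroup.quotientBot (G := G)).toEquiv.symm]
    rfl
  · have := ModuleCat.isZero_iff_subsingleton.1
      (isZero_groupCohomology_succ_of_subsingleton
        (Rep.of (ρ.comp (⊥ : Subgroup G).subtype)) n)
    exact (finrank_zero_of_subsingleton (R := F)).le

omit [Finite G] [FiniteDimensional F M] in
theorem hdim_comp_equiv {H : Type} [Group H] (e : H ≃* G) (ρ : Representation F G M) (n : ℕ) :
    hdim n (ρ.comp e.toMonoidHom) = hdim n ρ :=
  (mapIso (A := Rep.of ρ) (B := Rep.of (ρ.comp e.toMonoidHom)) e (LinearEquiv.refl F M)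
    (fun _ => rfl) n).toLinearEquiv.finrank_eq

theorem hdim_le_of_injective {H : Type} [Group H] (f : H →* G) (hf : Function.Injective f)
    (hi : (f.range.index : F) ≠ 0) (ρ : Representation F G M) (n : ℕ) :
    hdim n ρ ≤ hdim n (ρ.comp f) := by
  refine (hdim_le_of_index f.range hi ρ n).trans ?_
  rw [← hdim_comp_equiv (MonoidHom.ofInjective hf)]
  rfl

theorem hdim_succ_eq_zero_of_card (hG : (Nat.card G : F) ≠ 0) (ρ : Representation F G M) (n : ℕ) :
    hdim (n + 1) ρ = 0 := by
  refine hdim_succ_eq_zero ρ ((Nat.card G : F)⁻¹ • LinearMap.id) (fun m => ?_) n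
  cases nonempty_fintype G
  simp only [LinearMap.smul_apply, map_smul, LinearMap.id_apply, finsum_eq_sum_of_fintype,
    Representation.self_inv_apply, Finset.sum_const, Finset.card_univ, ← Nat.card_eq_fintype_card]
  rw [← Nat.cast_smul_eq_nsmul F, smul_smul, mul_inv_cancel₀ hG, one_smul]

end Transfer

section FunctionModules

variable {F G : Type} [Field F] [Group G] {M : Type} [AddCommGroup M] [Module F M]
  (ρ : Representation F G M) (Y : Type) [MulAction G Y]

/-- The representation of `G` on functions from a `G`-set to a representation. -/
def funRep : Representation F G (Y → M) where
  toFun g :=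
    { toFun := fun f y => ρ g (f (g⁻¹ • y))
      map_add' := fun _ _ => by ext; simp
      map_smul' := fun _ _ => by ext; simp }
  map_one' := by ext; simp
  map_mul' g h := by
    ext f y
    simp [mul_smul]

@[simp] theorem funRep_apply (g : G) (f : Y → M) (y : Y) :
    funRep ρ Y g f y = ρ g (f (g⁻¹ • y)) := rfl

theorem hdim_succ_funRep [Finite G] [Finite Y] [FiniteDimensional F M] (w : Y → F)
    (hw : ∀ y, ∑ᶠ g : G, w (g⁻¹ • y) = 1) (n : ℕ) : hdim (n + 1) (funRep ρ Y) = 0 := by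
  refine hdim_succ_eq_zero _
    { toFun := fun f y => w y • f y
      map_add' := fun _ _ => by ext; simp
      map_smul' := fun c f => by ext; simp [smul_comm c] } (fun f => ?_) n
  ext y
  cases nonempty_fintype G
  rw [finsum_eq_sum_of_fintype, Finset.sum_apply]
  have := hw y
  rw [finsum_eq_sum_of_fintype] at this
  simp [← Finset.sum_smul, this]

variable (F M) in
/-- Additive functions of pairs, in the sense of the difference cocycles. -/
def diffSub (Y : Type) : Submodule F (Y → Y → M) where
  carrier := {f | ∀ x y z, f x y + f y z = f x z}
  add_mem' {a b} ha hb x y z := by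
    simp only [Pi.add_apply, ← ha x y z, ← hb x y z]; abel
  zero_mem' x y z := by simp
  smul_mem' c a ha x y z := by simp [← ha x y z]

/-- The representation of `G` on additive functions of pairs. -/
def diffRep : Representation F G (diffSub F M Y) where
  toFun g :=
    { toFun := fun f => ⟨fun x y => ρ g (f.1 (g⁻¹ • x) (g⁻¹ • y)), fun x y z => by
        rw [← map_add, f.2]⟩
      map_add' := fun _ _ => by ext; simp
      map_smul' := fun _ _ => by ext; simp }
  map_one' := by ext; simp
  map_mul' g h := by
    ext f y
    simp [mul_smul]

@[simp] theorem diffRep_apply (g : G) (f : diffSub F M Y) (x y : Y) :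
    (diffRep ρ Y g f).1 x y = ρ g (f.1 (g⁻¹ • x) (g⁻¹ • y)) := rfl

/-- Constant functions. -/
def constMap : ρ.IntertwiningMap (funRep ρ Y) where
  toFun m := fun _ => m
  map_add' _ _ := rfl
  map_smul' _ _ := rfl
  isIntertwining' _ := rfl

/-- The difference map from functions to additive functions of pairs. -/
def diffMap : (funRep ρ Y).IntertwiningMap (diffRep ρ Y) where
  toFun f := ⟨fun x y => f x - f y, fun x y z => sub_add_sub_cancel _ _ _⟩
  map_add' _ _ := by ext; simp; abel
  map_smul' _ _ := by ext; simp [smul_sub]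
  isIntertwining' g := by ext; simp

theorem isSES_diff [Nonempty Y] : IsSES (constMap ρ Y) (diffMap ρ Y) where
  inj a b h := congrFun h (Classical.arbitrary Y)
  surj f := by
    refine ⟨fun y => f.1 y (Classical.arbitrary Y), ?_⟩
    ext x y
    change f.1 x _ - f.1 y _ = f.1 x y
    rw [sub_eq_iff_eq_add, f.2]
  exact f := by
    refine ⟨fun h => ⟨f (Classical.arbitrary Y), funext fun y => ?_⟩, ?_⟩
    · exact (sub_eq_zero.1 (congrFun (congrFun (congrArg Subtype.val h) y) _)).symm
    · rintro ⟨m, rfl⟩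
      ext
      exact sub_self _

variable {ρ Y}

theorem hdim_succ_funRep_self [Finite G] [FiniteDimensional F M] (S : Subgroup G)
    (τ : Representation F S M) (n : ℕ) :
    hdim (n + 1) (funRep τ G) = 0 := by
  classical
  let out : G → G := fun y => (Quotient.out (Quotient.mk (QuotientGroup.rightRel S) y))
  have hout : ∀ y, y * (out y)⁻¹ ∈ S := fun y =>
    QuotientGroup.rightRel_apply.1 (Quotient.exact (Quotient.out_eq _))
  have hout2 : ∀ (s : S) (y : G), out (s • y) = out y := fun s y => by
    have : Quotient.mk (QuotientGroup.rightRel S) (s • y) = Quotient.mk _ y :=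
      Quotient.sound (QuotientGroup.rightRel_apply.2 (by
        simp [Subgroup.smul_def]))
    simp only [out, this]
  refine hdim_succ_funRep τ G (fun y => if y = out y then 1 else 0) (fun y => ?_) n
  cases nonempty_fintype S
  rw [finsum_eq_sum_of_fintype, Finset.sum_eq_single ⟨_, hout y⟩]
  · rw [hout2]
    simp [Subgroup.smul_def]
  · intro s _ hs
    rw [hout2, if_neg]
    contrapose! hs
    ext
    simp [← hs, Subgroup.smul_def]
  · simp

end FunctionModules

section LHS

variable {F G : Type} [Field F] [Group G] {M M' : Type} [AddCommGroup M] [Module F M]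
  [AddCommGroup M'] [Module F M']

/-- The map induced on invariants of a normal subgroup. -/
def invMap {ρ : Representation F G M} {σ : Representation F G M'} (f : ρ.IntertwiningMap σ)
    (S : Subgroup G) [S.Normal] :
    (ρ.quotientToInvariants S).IntertwiningMap (σ.quotientToInvariants S) where
  toFun x := ⟨f x.1, fun s => by
    change σ s (f x.1) = f x.1
    rw [← Representation.IntertwiningMap.isIntertwining]
    exact congrArg f (x.2 s)⟩
  map_add' _ _ := by ext; simp
  map_smul' _ _ := by ext; simp
  isIntertwining' g := by
    induction g using QuotientGroup.induction_on with | H g => ?_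
    ext x
    exact Representation.IntertwiningMap.isIntertwining _ _ f g x.1

/-- An intertwining map with its range as codomain. -/
def toRange {ρ : Representation F G M} {σ : Representation F G M'} (f : ρ.IntertwiningMap σ) :
    ρ.IntertwiningMap f.range.toRepresentation where
  toLinearMap := f.toLinearMap.rangeRestrict
  isIntertwining' g := by
    ext x
    exact Representation.IntertwiningMap.isIntertwining _ _ f g x

/-- The inclusion of a subrepresentation. -/
def subIncl {ρ : Representation F G M} (W : Subrepresentation ρ) :
    W.toRepresentation.IntertwiningMap ρ where
  toLinearMap := W.toSubmodule.subtype
  isIntertwining' g := by ext x; rfl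

/-- The quotient by a subrepresentation. -/
def subQuot {ρ : Representation F G M} (W : Subrepresentation ρ) :
    Representation F G (M ⧸ W.toSubmodule) :=
  ρ.quotient W.toSubmodule fun g _ hx => W.apply_mem_toSubmodule g hx

/-- The projection onto the quotient by a subrepresentation. -/
def subMkQ {ρ : Representation F G M} (W : Subrepresentation ρ) :
    ρ.IntertwiningMap (subQuot W) where
  toLinearMap := W.toSubmodule.mkQ
  isIntertwining' g := by ext x; rfl

theorem isSES_sub {ρ : Representation F G M} (W : Subrepresentation ρ) :
    IsSES (subIncl W) (subMkQ W) where
  inj := Subtype.val_injective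
  surj := Submodule.mkQ_surjective _
  exact x := by
    change W.toSubmodule.mkQ x = 0 ↔ _
    rw [Submodule.mkQ_apply, Submodule.Quotient.mk_eq_zero]
    exact ⟨fun h => ⟨⟨x, h⟩, rfl⟩, by rintro ⟨y, rfl⟩; exact y.2⟩

theorem idim_quotientToInvariants (ρ : Representation F G M) (S : Subgroup G) [S.Normal] :
    idim (ρ.quotientToInvariants S) = idim ρ := by
  refine LinearEquiv.finrank_eq
    { toFun := fun x => ⟨x.1.1, fun g => congrArg Subtype.val (x.2 (QuotientGroup.mk g))⟩
      map_add' := fun _ _ => rfl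
      map_smul' := fun _ _ => rfl
      invFun := fun x => ⟨⟨x.1, fun s => x.2 s⟩, fun g => by
        induction g using QuotientGroup.induction_on with | H g => ?_
        exact Subtype.ext (x.2 g)⟩
      left_inv := fun _ => rfl
      right_inv := fun _ => rfl }

variable [Finite G] [FiniteDimensional F M]

theorem hdim_succ_quotientToInvariants_funRep (ρ : Representation F G M) (S : Subgroup G)
    [S.Normal] (n : ℕ) : hdim (n + 1) ((funRep ρ G).quotientToInvariants S) = 0 := by
  classical
  have hinv (f : Representation.invariants ((funRep ρ G).comp S.subtype)) :
      (fun y => if y ∈ S then f.1 y else 0) ∈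
        Representation.invariants ((funRep ρ G).comp S.subtype) := fun s => by
    ext y
    have h := congrFun (f.2 s) y
    have hm : (s : G)⁻¹ • y ∈ S ↔ y ∈ S := by
      rw [smul_eq_mul]; exact Subgroup.mul_mem_cancel_left S (inv_mem s.2)
    change ρ s (if (s : G)⁻¹ • y ∈ S then f.1 ((s : G)⁻¹ • y) else 0) = if y ∈ S then f.1 y else 0
    change ρ s (f.1 ((s : G)⁻¹ • y)) = f.1 y at h
    rw [← h]
    simp only [hm]
    split_ifs <;> simp
  refine hdim_succ_eq_zero ((funRep ρ G).quotientToInvariants S)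
    { toFun := fun f => ⟨fun y => if y ∈ S then f.1 y else 0, hinv f⟩
      map_add' := fun _ _ => by ext y; by_cases hy : y ∈ S <;> simp [hy]
      map_smul' := fun c f => by ext; simp } (fun f => ?_) n
  · cases nonempty_fintype (G ⧸ S)
    rw [finsum_eq_sum_of_fintype]
    ext y
    rw [AddSubmonoidClass.coe_finsetSum, Finset.sum_apply,
      Finset.sum_eq_single (QuotientGroup.mk y)]
    · change ρ y (if y⁻¹ • y ∈ S then ρ y⁻¹ (f.1 (y⁻¹⁻¹ • y⁻¹ • y)) else 0) = f.1 y
      simp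
    · intro q _ hq
      induction q using QuotientGroup.induction_on with | H g => ?_
      change ρ g (if g⁻¹ • y ∈ S then ρ g⁻¹ (f.1 (g⁻¹⁻¹ • g⁻¹ • y)) else 0) = 0
      rw [if_neg, map_zero]
      rwa [smul_eq_mul, ← QuotientGroup.eq]
    · simp

theorem finrank_range_le_of_mem {A B C : Type} [AddCommGroup A] [Module F A] [AddCommGroup B]
    [Module F B] [AddCommGroup C] [Module F C] [FiniteDimensional F B] (f : A →ₗ[F] C)
    (g : B →ₗ[F] C) (h : ∀ x, f x ∈ LinearMap.range g) :
    finrank F (LinearMap.range f) ≤ finrank F B :=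
  (Submodule.finrank_mono (by rintro _ ⟨x, rfl⟩; exact h x)).trans (LinearMap.finrank_range_le g)

theorem hdim_one_le_infRes (ρ : Representation F G M) (S R : Subgroup G) [S.Normal] (h : S ≤ R) :
    hdim 1 ρ ≤ hdim 1 (ρ.quotientToInvariants S) + hdim 1 (ρ.comp R.subtype) := by
  let A := Rep.of ρ
  have e := finrank_of_exact (H1InfRes_exact A S) (finite_groupCohomology A 1)
  have hf : FiniteDimensional F (H1InfRes A S).X₁ :=
    finite_groupCohomology (Rep.of (ρ.quotientToInvariants S)) 1
  have hR := finite_groupCohomology (Rep.of (ρ.comp R.subtype)) 1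
  have hS := finite_groupCohomology (Rep.of (ρ.comp S.subtype)) 1
  let g : groupCohomology (Rep.of (ρ.comp R.subtype)) 1 ⟶
      groupCohomology (Rep.of (ρ.comp S.subtype)) 1 :=
    map (A := Rep.of (ρ.comp R.subtype)) (B := Rep.of (ρ.comp S.subtype))
        (Subgroup.inclusion h) (𝟙 (Rep.of (ρ.comp S.subtype))) 1
  have hc : (H1InfRes A S).g =
      map (A := A) (B := Rep.of (ρ.comp R.subtype)) R.subtype (𝟙 (Rep.of (ρ.comp R.subtype))) 1 ≫
        g :=
    map_comp (A := A) (B := Rep.of (ρ.comp R.subtype)) (C := Rep.of (ρ.comp S.subtype))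
      R.subtype (Subgroup.inclusion h) (𝟙 (Rep.of (ρ.comp R.subtype)))
      (𝟙 (Rep.of (ρ.comp S.subtype))) 1
  have hr : ∀ x, (H1InfRes A S).g.hom x ∈ LinearMap.range g.hom := fun x => by
    rw [hc]
    exact ⟨_, rfl⟩
  exact e.le.trans (add_le_add (LinearMap.finrank_range_le (H1InfRes A S).f.hom)
    (finrank_range_le_of_mem (H1InfRes A S).g.hom g.hom hr))

omit [Finite G] in
theorem isSES_toRange {M₁ M₂ M₃ : Type} [AddCommGroup M₁] [Module F M₁] [AddCommGroup M₂]
    [Module F M₂] [AddCommGroup M₃] [Module F M₃] {ρ₁ : Representation F G M₁}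
    {ρ₂ : Representation F G M₂} {ρ₃ : Representation F G M₃} {i : ρ₁.IntertwiningMap ρ₂}
    {q : ρ₂.IntertwiningMap ρ₃} (hi : Function.Injective i)
    (h : ∀ x, q x = 0 ↔ ∃ y, i y = x) : IsSES i (toRange q) where
  inj := hi
  surj := LinearMap.surjective_rangeRestrict _
  exact x := by
    rw [← h]
    exact ⟨fun hx => congrArg Subtype.val hx, fun hx => Subtype.ext hx⟩

theorem exists_cokernel {M₁ M₂ M₃ : Type} [AddCommGroup M₁] [Module F M₁] [AddCommGroup M₂]
    [Module F M₂] [AddCommGroup M₃] [Module F M₃] [FiniteDimensional F M₁]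
    [FiniteDimensional F M₂] [FiniteDimensional F M₃] {ρ₁ : Representation F G M₁}
    {ρ₂ : Representation F G M₂} {ρ₃ : Representation F G M₃} {i : ρ₁.IntertwiningMap ρ₂}
    {q : ρ₂.IntertwiningMap ρ₃} (hi : Function.Injective i)
    (h : ∀ x, q x = 0 ↔ ∃ y, i y = x) (ac : ∀ n, hdim (n + 1) ρ₂ = 0) :
    ∃ (W : Type) (_ : AddCommGroup W) (_ : Module F W) (_ : FiniteDimensional F W)
      (τ : Representation F G W), finrank F M₃ + finrank F M₁ = finrank F M₂ + finrank F W ∧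
      idim ρ₃ + idim ρ₁ ≤ hdim 1 ρ₁ + idim ρ₂ + idim τ ∧ hdim 1 ρ₃ ≤ hdim 2 ρ₁ + hdim 1 τ := by
  have ses1 := isSES_toRange hi h
  have ses2 := isSES_sub q.range
  have a3 := ses1.hdim_one_add (ac 0)
  have a4 := ses2.idim_le
  have a5 := ses1.finrank_eq
  have a6 := ses2.finrank_eq
  have a8 := ses1.hdim_two_eq (ac 0) (ac 1)
  have a9 := ses2.hdim_le 1
  exact ⟨_, inferInstance, inferInstance, inferInstance, subQuot q.range,
    by omega, by omega, by omega⟩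

omit [Finite G] in
theorem exact_invMap {M₁ M₂ M₃ : Type} [AddCommGroup M₁] [Module F M₁] [AddCommGroup M₂]
    [Module F M₂] [AddCommGroup M₃] [Module F M₃] {ρ₁ : Representation F G M₁}
    {ρ₂ : Representation F G M₂} {ρ₃ : Representation F G M₃} {i : ρ₁.IntertwiningMap ρ₂}
    {q : ρ₂.IntertwiningMap ρ₃} (h : IsSES i q) (S : Subgroup G) [S.Normal]
    (x : Representation.invariants (ρ₂.comp S.subtype)) :
    invMap q S x = 0 ↔ ∃ y, invMap i S y = x := by
  have key : invMap q S x = 0 ↔ q x.1 = 0 :=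
    ⟨fun hx => congrArg Subtype.val hx, fun hx => Subtype.ext hx⟩
  rw [key, h.exact]
  constructor
  · rintro ⟨m, hm⟩
    refine ⟨⟨m, fun s => h.inj ?_⟩, Subtype.ext hm⟩
    have h1 : i (ρ₁ s m) = ρ₂ s (i m) := Representation.IntertwiningMap.isIntertwining _ _ i s m
    refine h1.trans ?_
    rw [hm]
    exact x.2 s
  · rintro ⟨y, rfl⟩
    exact ⟨y.1, rfl⟩

theorem IsSES.exists_cokernel_invMap {M₁ M₂ M₃ : Type} [AddCommGroup M₁] [Module F M₁]
    [AddCommGroup M₂] [Module F M₂] [AddCommGroup M₃] [Module F M₃] [FiniteDimensional F M₁]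
    [FiniteDimensional F M₂] [FiniteDimensional F M₃] {ρ₁ : Representation F G M₁}
    {ρ₂ : Representation F G M₂} {ρ₃ : Representation F G M₃} {i : ρ₁.IntertwiningMap ρ₂}
    {q : ρ₂.IntertwiningMap ρ₃} (h : IsSES i q) (S : Subgroup G) [S.Normal]
    (ac : ∀ n, hdim (n + 1) (ρ₂.quotientToInvariants S) = 0) :
    ∃ (W : Type) (_ : AddCommGroup W) (_ : Module F W) (_ : FiniteDimensional F W)
      (τ : Representation F (G ⧸ S) W),
      idim (ρ₃.comp S.subtype) + idim (ρ₁.comp S.subtype) =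
        idim (ρ₂.comp S.subtype) + finrank F W ∧
      idim ρ₃ + idim ρ₁ ≤ hdim 1 (ρ₁.quotientToInvariants S) + idim ρ₂ + idim τ ∧
      hdim 1 (ρ₃.quotientToInvariants S) ≤ hdim 2 (ρ₁.quotientToInvariants S) + hdim 1 τ := by
  obtain ⟨W, iW, jW, kW, τ, c1, c2, c3⟩ := exists_cokernel (i := invMap i S)
    (q := invMap q S) (fun a b hab => Subtype.ext (h.inj (congrArg Subtype.val hab)))
    (exact_invMap h S) ac
  rw [idim_quotientToInvariants, idim_quotientToInvariants, idim_quotientToInvariants] at c2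
  exact ⟨W, iW, jW, kW, τ, c1, c2, c3⟩

theorem exists_quotient_bound (ρ : Representation F G M) (S : Subgroup G) [S.Normal] :
    ∃ (W : Type) (_ : AddCommGroup W) (_ : Module F W) (_ : FiniteDimensional F W)
      (τ : Representation F (G ⧸ S) W), finrank F W = hdim 1 (ρ.comp S.subtype) ∧
      hdim 1 ρ ≤ hdim 1 (ρ.quotientToInvariants S) + idim τ ∧
      ∀ R : Subgroup G, S ≤ R → hdim 2 ρ ≤
        hdim 2 (ρ.quotientToInvariants S) + hdim 1 τ + hdim 2 (ρ.comp R.subtype) := by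
  have ac (R : Subgroup G) (n : ℕ) : hdim (n + 1) ((funRep ρ G).comp R.subtype) = 0 :=
    hdim_succ_funRep_self R (ρ.comp R.subtype) n
  have ses (R : Subgroup G) :
      IsSES (constMap (ρ.comp R.subtype) G) (diffMap (ρ.comp R.subtype) G) :=
    isSES_diff _ _
  have acG (n : ℕ) : hdim (n + 1) (funRep ρ G) = 0 := by
    rw [← hdim_comp_equiv Subgroup.topEquiv]; exact ac ⊤ n
  have sesG := isSES_diff ρ G
  have ac1 := fun n => hdim_succ_quotientToInvariants_funRep ρ S n
  have a1 := (ses S).hdim_one_add (ac S 0)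
  have a2 := sesG.hdim_one_add (acG 0)
  have a7 := sesG.hdim_two_eq (acG 0) (acG 1)
  obtain ⟨W, iW, jW, kW, τ, c1, c2, c3⟩ := sesG.exists_cokernel_invMap S ac1
  refine ⟨W, iW, jW, kW, τ, ?_, ?_, ?_⟩
  · change hdim 1 (ρ.comp S.subtype) + idim ((funRep ρ G).comp S.subtype) =
      idim ((diffRep ρ G).comp S.subtype) + idim (ρ.comp S.subtype) at a1
    omega
  · omega
  · intro R hR
    have b1 := (ses R).hdim_two_eq (ac R 0) (ac R 1)
    have b2 := hdim_one_le_infRes (diffRep ρ G) S R hR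
    change _ = hdim 1 ((diffRep ρ G).comp R.subtype) at b1
    omega

end LHS

section Bounds

/-- The dimension of every representation of `G` over `F` bounds the indicated combination of
the dimensions of its cohomology groups in degrees `0`, `1` and `2`. -/
def CohBound (F G : Type) [Field F] [Group G] (b c : ℕ) : Prop :=
  ∀ (M : Type) [AddCommGroup M] [Module F M] [FiniteDimensional F M] (ρ : Representation F G M),
    idim ρ + b * hdim 1 ρ + c * hdim 2 ρ ≤ finrank F M

variable {F G H Q : Type} [Field F] [Group G] [Group H] [Group Q] {b c d k : ℕ}

theorem idim_le_finrank {M : Type} [AddCommGroup M] [Module F M] [FiniteDimensional F M]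
    (ρ : Representation F G M) : idim ρ ≤ finrank F M :=
  Submodule.finrank_le _

theorem CohBound.of_equiv (h : CohBound F G b c) (e : G ≃* H) : CohBound F H b c := by
  intro M _ _ _ ρ
  have := h M (ρ.comp e.toMonoidHom)
  rwa [← hdim_zero, hdim_comp_equiv, hdim_comp_equiv, hdim_comp_equiv, hdim_zero] at this

theorem CohBound.of_injective [Finite G] (h : CohBound F H b c) (f : H →* G)
    (hf : Function.Injective f) (hi : (f.range.index : F) ≠ 0) : CohBound F G b c := by
  intro M _ _ _ ρ
  have := h M (ρ.comp f)
  have h0 := hdim_le_of_injective f hf hi ρ 0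
  rw [hdim_zero, hdim_zero] at h0
  have h1 := Nat.mul_le_mul_left b (hdim_le_of_injective f hf hi ρ 1)
  have h2 := Nat.mul_le_mul_left c (hdim_le_of_injective f hf hi ρ 2)
  omega

theorem cohBound_of_card [Finite G] (hG : (Nat.card G : F) ≠ 0) (b c : ℕ) : CohBound F G b c := by
  intro M _ _ _ ρ
  rw [hdim_succ_eq_zero_of_card hG, hdim_succ_eq_zero_of_card hG]
  simpa using idim_le_finrank ρ

theorem CohBound.extension_subgroup [Finite G] (N : Subgroup G) [N.Normal]
    (hQ : CohBound F (G ⧸ N) b c) (hN : CohBound F N k c)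
    (hW : ∀ (W : Type) [AddCommGroup W] [Module F W] [FiniteDimensional F W]
      (τ : Representation F (G ⧸ N) W), b * idim τ + c * hdim 1 τ ≤ k * finrank F W) :
    CohBound F G b c := by
  intro M _ _ _ ρ
  obtain ⟨W, _, _, _, τ, h0, h1, h2⟩ := exists_quotient_bound ρ N
  have a1 := hW W τ
  have a2 := hN M (ρ.comp N.subtype)
  have a3 := hQ _ (ρ.quotientToInvariants N)
  have h1 := Nat.mul_le_mul_left b h1
  have h2 := Nat.mul_le_mul_left c (h2 N le_rfl)
  rw [idim_quotientToInvariants] at a3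
  rw [h0] at a1
  simp only [Nat.mul_add] at h1 h2
  have a4 : finrank F (Representation.invariants (ρ.comp N.subtype)) =
    idim (ρ.comp N.subtype) := rfl
  omega

theorem CohBound.extension [Finite G] (f : H →* G) (hf : Function.Injective f) (π : G →* Q)
    (hπ : Function.Surjective π) (hr : f.range = π.ker)
    (hQ : CohBound F Q b c) (hN : CohBound F H k c)
    (hW : ∀ (W : Type) [AddCommGroup W] [Module F W] [FiniteDimensional F W]
      (τ : Representation F Q W), b * idim τ + c * hdim 1 τ ≤ k * finrank F W) :
    CohBound F G b c := by
  have e := QuotientGroup.quotientKerEquivOfSurjective π hπ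
  have e2 : H ≃* π.ker := (MonoidHom.ofInjective hf).trans (MulEquiv.subgroupCongr hr)
  refine CohBound.extension_subgroup π.ker (hQ.of_equiv e.symm) (hN.of_equiv e2) ?_
  intro W _ _ _ τ
  have := hW W (τ.comp e.symm.toMonoidHom)
  rwa [← hdim_zero, hdim_comp_equiv, hdim_comp_equiv, hdim_zero] at this

/-- Bounds on the first and on the second cohomology. -/
def WeakBound (F G : Type) [Field F] [Group G] (d : ℕ) : Prop :=
  CohBound F G d 0 ∧ CohBound F G 0 d

/-- Bounds on cohomology in degrees at most `2` that are inherited by group extensions. -/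
def StrongBound (F G : Type) [Field F] [Group G] (d : ℕ) : Prop :=
  CohBound F G d 0 ∧ CohBound F G 1 d

theorem StrongBound.extension [Finite G] (f : H →* G) (hf : Function.Injective f) (π : G →* Q)
    (hπ : Function.Surjective π) (hr : f.range = π.ker)
    (hQ : StrongBound F Q d) (hN : StrongBound F H d) : StrongBound F G d := by
  refine ⟨hQ.1.extension f hf π hπ hr hN.1 ?_, hQ.2.extension f hf π hπ hr hN.2 ?_⟩
  · intro W _ _ _ τ
    simpa using Nat.mul_le_mul_left d (idim_le_finrank τ)
  · intro W _ _ _ τ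
    simpa using hQ.1 W τ

theorem WeakBound.extension [Finite G] (f : H →* G) (hf : Function.Injective f) (π : G →* Q)
    (hπ : Function.Surjective π) (hr : f.range = π.ker)
    (hQ : WeakBound F Q d) (hN : StrongBound F H d) : WeakBound F G d := by
  refine ⟨hQ.1.extension f hf π hπ hr hN.1 ?_, hQ.2.extension (k := 1) f hf π hπ hr hN.2 ?_⟩
  · intro W _ _ _ τ
    simpa using Nat.mul_le_mul_left d (idim_le_finrank τ)
  · intro W _ _ _ τ
    have := hQ.1 W τ
    simp only [Nat.zero_mul, Nat.one_mul] at this ⊢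
    omega

theorem hdim_le_quotientToInvariants [Finite G] {M : Type} [AddCommGroup M] [Module F M]
    [FiniteDimensional F M] (ρ : Representation F G M) (L : Subgroup G) [L.Normal]
    (hL : (Nat.card L : F) ≠ 0) :
    hdim 1 ρ ≤ hdim 1 (ρ.quotientToInvariants L) ∧
      hdim 2 ρ ≤ hdim 2 (ρ.quotientToInvariants L) := by
  obtain ⟨W, _, _, _, τ, h0, h1, h2⟩ := exists_quotient_bound ρ L
  have h2 := h2 L le_rfl
  rw [hdim_succ_eq_zero_of_card hL] at h0 h2
  have : Subsingleton W := finrank_zero_iff.1 h0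
  have i0 := idim_le_finrank τ
  have i1 : hdim 1 τ = 0 := by
    refine hdim_succ_eq_zero τ 0 (fun m => Subsingleton.elim _ _) 0
  omega

end Bounds

section Alternating

variable {F G : Type} [Field F] [Group G] {M : Type} [AddCommGroup M] [Module F M]
  (ρ : Representation F G M) (X : Type) [MulAction G X]

/-- Equivariant alternating homogeneous `2`-cocycles on a `G`-set. -/
def altSub : Submodule F (X → X → X → M) where
  carrier := {f | (∀ x y z, f x y z = - f y x z) ∧ (∀ x y z, f x y z = - f x z y) ∧
    (∀ x y z w, f y z w - f x z w + f x y w - f x y z = 0) ∧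
    ∀ (g : G) x y z, ρ g (f x y z) = f (g • x) (g • y) (g • z)}
  add_mem' {a b} ha hb := by
    refine ⟨fun x y z => ?_, fun x y z => ?_, fun x y z w => ?_, fun g x y z => ?_⟩
    · simp only [Pi.add_apply, ha.1 x y z, hb.1 x y z]; abel
    · simp only [Pi.add_apply, ha.2.1 x y z, hb.2.1 x y z]; abel
    · simp only [Pi.add_apply]
      rw [← add_zero (0 : M)]
      nth_rewrite 1 [← ha.2.2.1 x y z w]
      rw [← hb.2.2.1 x y z w]; abel
    · simp only [Pi.add_apply, map_add, ha.2.2.2, hb.2.2.2]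
  zero_mem' := by simp
  smul_mem' c a ha := by
    refine ⟨fun x y z => ?_, fun x y z => ?_, fun x y z w => ?_, fun g x y z => ?_⟩
    · simp only [Pi.smul_apply, ha.1 x y z, smul_neg]
    · simp only [Pi.smul_apply, ha.2.1 x y z, smul_neg]
    · simp only [Pi.smul_apply, ← smul_sub, ← smul_add, ha.2.2.1 x y z w, smul_zero]
    · simp only [Pi.smul_apply, map_smul, ha.2.2.2]

variable {ρ X}

theorem mem_invariants_diffRep {f : diffSub F M X} (hf : f ∈ (diffRep ρ X).invariants) (g : G)
    (x y : X) : ρ g (f.1 x y) = f.1 (g • x) (g • y) := by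
  have := congrFun (congrFun (congrArg Subtype.val (hf g)) (g • x)) (g • y)
  simpa using this

theorem diffSub_self (f : diffSub F M X) (x : X) : f.1 x x = 0 := by
  simpa using f.2 x x x

theorem diffSub_symm (f : diffSub F M X) (x y : X) : f.1 x y = - f.1 y x := by
  rw [eq_neg_iff_add_eq_zero, f.2, diffSub_self]

theorem idim_le_of_injective {M' : Type} [AddCommGroup M'] [Module F M']
    [FiniteDimensional F M'] {σ : Representation F G M'} (i : ρ.IntertwiningMap σ)
    (hi : Function.Injective i) : idim ρ ≤ idim σ := by
  refine LinearMap.finrank_le_finrank_of_injective (f := LinearMap.restrict i.toLinearMap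
    (p := ρ.invariants) (q := σ.invariants) fun x hx g => ?_) fun a b h =>
      Subtype.ext (hi (congrArg Subtype.val h))
  change σ g (i x) = i x
  rw [← Representation.IntertwiningMap.isIntertwining, hx g]

section Pairings

variable {C : Type} [AddCommGroup C] [Module F C] (e : C ≃ₗ[F] diffSub F M X)
  (f : diffSub F C X)

/-- The pairing of pairs of points attached to an iterated difference function. -/
def pairing (x y z w : X) : M := (e (f.1 x y)).1 z w

theorem pairing_right (x y z w u : X) :
    pairing e f x y z w = pairing e f x y u w - pairing e f x y u z :=
  eq_sub_of_add_eq' ((e (f.1 x y)).2 u z w)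

theorem pairing_left (x y z w u : X) :
    pairing e f x y z w = pairing e f u y z w - pairing e f u x z w := by
  refine eq_sub_of_add_eq' ?_
  rw [pairing, pairing, pairing, ← f.2 u x y, map_add]
  rfl

theorem pairing_self_right (x y z : X) : pairing e f x y z z = 0 := diffSub_self _ _

theorem pairing_self_left (x z w : X) : pairing e f x x z w = 0 := by
  rw [pairing, diffSub_self, map_zero]; rfl

variable {e f} {σ : Representation F G C}
  (he : ∀ g c x y, (e (σ g c)).1 x y = ρ g ((e c).1 (g⁻¹ • x) (g⁻¹ • y)))

include he in
theorem pairing_equivariant (hf : f ∈ (diffRep σ X).invariants) (g : G) (x y z w : X) :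
    ρ g (pairing e f x y z w) = pairing e f (g • x) (g • y) (g • z) (g • w) := by
  rw [pairing, pairing, ← mem_invariants_diffRep hf, he, inv_smul_smul, inv_smul_smul]

/-- Antisymmetrization of invariant pairings. -/
noncomputable def altMap : (diffRep σ X).invariants →ₗ[F] altSub ρ X where
  toFun f := ⟨fun x y z => pairing e f.1 x y x z - pairing e f.1 x z x y, by
    refine ⟨fun x y z => ?_, fun x y z => ?_, fun x y z w => ?_, fun g x y z => ?_⟩
    · beta_reduce
      rw [pairing_left e f.1 y x y z x, pairing_left e f.1 y z y x x,
        pairing_right e f.1 x x y z x, pairing_right e f.1 x y y z x, pairing_right e f.1 x z y x x]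
      simp only [pairing_self_right, pairing_self_left, pairing_right e f.1 x y y x x]
      abel
    · beta_reduce
      abel
    · beta_reduce
      rw [pairing_left e f.1 y z y w x, pairing_left e f.1 y w y z x,
        pairing_right e f.1 x z y w x, pairing_right e f.1 x y y w x,
        pairing_right e f.1 x w y z x, pairing_right e f.1 x y y z x]
      abel
    · rw [map_sub, pairing_equivariant he f.2, pairing_equivariant he f.2]⟩
  map_add' a b := by ext x y z; simp [pairing]; abel
  map_smul' a b := by ext x y z; simp [pairing, smul_sub]

theorem exists_diffMap_eq [NeZero (2 : F)] {f : (diffRep σ X).invariants}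
    (hf : altMap he f = 0) : ∃ h ∈ (funRep σ X).invariants, diffMap σ X h = f.1 := by
  have h2 : (2 : F) ≠ 0 := NeZero.ne _
  have hs (x y z : X) : pairing e f.1 x y x z = pairing e f.1 x z x y :=
    sub_eq_zero.1 (congrFun (congrFun (congrFun (congrArg Subtype.val hf) x) y) z)
  let h (x : X) : diffSub F M X :=
    ⟨fun z w => (2 : F)⁻¹ • (pairing e f.1 x w x w - pairing e f.1 x z x z), fun a b c => by
      rw [← smul_add]; congr 1; abel⟩
  refine ⟨fun x => e.symm (h x), fun g => ?_, ?_⟩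
  · ext x
    apply e.injective
    ext z w
    rw [funRep_apply, he]
    simp [h, pairing_equivariant he f.2]
  · ext x y
    apply e.injective
    ext z w
    change (e (e.symm (h x) - e.symm (h y))).1 z w = pairing e f.1 x y z w
    rw [map_sub, e.apply_symm_apply, e.apply_symm_apply]
    change (2 : F)⁻¹ • (pairing e f.1 x w x w - pairing e f.1 x z x z) -
      (2 : F)⁻¹ • (pairing e f.1 y w y w - pairing e f.1 y z y z) = pairing e f.1 x y z w
    rw [pairing_left e f.1 y w y w x, pairing_right e f.1 x w y w x, pairing_right e f.1 x y y w x,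
      pairing_left e f.1 y z y z x, pairing_right e f.1 x z y z x, pairing_right e f.1 x y y z x,
      pairing_right e f.1 x y z w x, hs x w y, hs x z y, ← smul_sub, inv_smul_eq_iff₀ h2, two_smul]
    abel

include he in
theorem hdim_one_le_altSub [NeZero (2 : F)] [Finite G] [FiniteDimensional F M]
    [FiniteDimensional F C] [Finite X] [Nonempty X] (ac : hdim 1 (funRep σ X) = 0) :
    hdim 1 σ ≤ finrank F (altSub ρ X) := by
  have h1 := (isSES_diff σ X).hdim_one_add ac
  let D : (funRep σ X).invariants →ₗ[F] diffSub F C X := (diffMap σ X).toLinearMap.domRestrict _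
  have h2 := LinearMap.finrank_range_add_finrank_ker D
  have h3 := @LinearMap.finrank_range_add_finrank_ker F (diffRep σ X).invariants _
    (Submodule.addCommGroup _) _ (altSub ρ X) _ _ inferInstance (altMap he)
  have h4 : finrank F (LinearMap.range (altMap he)) ≤ finrank F (altSub ρ X) :=
    Submodule.finrank_le _
  have h5 : finrank F (LinearMap.ker (altMap he)) ≤ finrank F (LinearMap.range D) := by
    refine LinearMap.finrank_le_finrank_of_injective (f := LinearMap.codRestrict _
      ((Submodule.subtype _) ∘ₗ (Submodule.subtype _)) fun f => ?_) ?_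
    · obtain ⟨h, hh, e⟩ := exists_diffMap_eq he f.2
      exact ⟨⟨h, hh⟩, e⟩
    · intro a b hab
      have hab := congrArg Subtype.val hab
      exact Subtype.ext (Subtype.ext hab)
  have h6 : idim σ ≤ finrank F (LinearMap.ker D) := by
    have hc : ∀ c : σ.invariants, constMap σ X c ∈ (funRep σ X).invariants := fun c g => by
      rw [← Representation.IntertwiningMap.isIntertwining, c.2 g]
    refine LinearMap.finrank_le_finrank_of_injective (f := LinearMap.codRestrict _
      (LinearMap.codRestrict (funRep σ X).invariants
        ((constMap σ X).toLinearMap.domRestrict _) hc) fun c => ?_) ?_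
    · exact ((isSES_diff σ X).exact _).2 ⟨c.1, rfl⟩
    · intro a b hab
      refine Subtype.ext ((isSES_diff σ X).inj ?_)
      exact congrArg (fun a => a.1.1) hab
  change _ = idim (funRep σ X) at h2
  change _ = idim (diffRep σ X) at h3
  omega

end Pairings

variable [Finite G] [FiniteDimensional F M] [Finite X] [Nonempty X]

theorem hdim_one_le_diffRep (ac : hdim 1 (funRep ρ X) = 0) :
    hdim 1 ρ ≤ idim (diffRep ρ X) := by
  have h := isSES_diff ρ X
  have h1 := h.hdim_one_add ac
  have h2 := idim_le_of_injective _ h.inj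
  omega

theorem hdim_two_le_altSub [NeZero (2 : F)]
    (ac : ∀ n, hdim (n + 1) (funRep ρ X) = 0) (ac2 : hdim 1 (funRep (diffRep ρ X) X) = 0) :
    hdim 2 ρ ≤ finrank F (altSub ρ X) := by
  rw [(isSES_diff ρ X).hdim_two_eq (ac 0) (ac 1)]
  exact hdim_one_le_altSub (e := LinearEquiv.refl F (diffSub F M X)) (fun g c x y => rfl) ac2

end Alternating

section Permutations

variable {F G X : Type} [Field F] [Group G] [MulAction G X]

theorem hdim_succ_funRep_of_isPretransitive [Finite G] [Finite X] [MulAction.IsPretransitive G X]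
    (x : X) (hx : (Nat.card (MulAction.stabilizer G x) : F) ≠ 0) {M : Type} [AddCommGroup M]
    [Module F M] [FiniteDimensional F M] (ρ : Representation F G M) (n : ℕ) :
    hdim (n + 1) (funRep ρ X) = 0 := by
  classical
  refine hdim_succ_funRep ρ X
    (fun y => if y = x then (Nat.card (MulAction.stabilizer G x) : F)⁻¹ else 0) (fun y => ?_) n
  cases nonempty_fintype G
  obtain ⟨h, rfl⟩ := MulAction.exists_smul_eq G x y
  rw [finsum_eq_sum_of_fintype, ← Equiv.sum_comp (Equiv.mulLeft h), Finset.sum_ite,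
    Finset.sum_const_zero, add_zero, Finset.sum_const, nsmul_eq_mul]
  convert mul_inv_cancel₀ hx
  rw [Nat.card_eq_fintype_card, Fintype.card_subtype]
  congr 1
  ext g
  simp only [Finset.mem_filter, Finset.mem_univ, true_and, Equiv.coe_mulLeft, mul_inv_rev,
    mul_smul, inv_smul_smul, MulAction.mem_stabilizer_iff]
  rw [inv_smul_eq_iff, eq_comm]

variable (G X) in
/-- The action of `G` induces all even permutations. -/
def InducesEven [Fintype X] [DecidableEq X] : Prop :=
  ∀ σ : Equiv.Perm X, Equiv.Perm.sign σ = 1 → ∃ g : G, ∀ x : X, g • x = σ x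

variable [Fintype X] [DecidableEq X]

omit [DecidableEq X] in
theorem exists_notMem_of_card_lt (s : Finset X) (h : s.card < Fintype.card X) : ∃ x, x ∉ s := by
  obtain ⟨x, -, hx⟩ := Finset.exists_mem_notMem_of_card_lt_card (t := Finset.univ) h
  exact ⟨x, hx⟩

theorem InducesEven.exists_double_swap (hG : InducesEven G X) {a b c d : X} (hab : a ≠ b)
    (hac : a ≠ c) (had : a ≠ d) (hbc : b ≠ c) (hbd : b ≠ d) (hcd : c ≠ d) :
    ∃ g : G, g • a = b ∧ g • b = a ∧ g • c = d ∧ g • d = c ∧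
      ∀ x, x ≠ a → x ≠ b → x ≠ c → x ≠ d → g • x = x := by
  obtain ⟨g, hg⟩ := hG (Equiv.swap a b * Equiv.swap c d)
    (by rw [Equiv.Perm.sign_mul, Equiv.Perm.sign_swap hab, Equiv.Perm.sign_swap hcd]; rfl)
  refine ⟨g, ?_, ?_, ?_, ?_, fun x h1 h2 h3 h4 => ?_⟩ <;>
    simp_all [Equiv.swap_apply_def] <;> grind

theorem InducesEven.exists_cycle (hG : InducesEven G X) {a b c : X} (hab : a ≠ b)
    (hac : a ≠ c) (hbc : b ≠ c) :
    ∃ g : G, g • a = b ∧ g • b = c ∧ g • c = a ∧ ∀ x, x ≠ a → x ≠ b → x ≠ c → g • x = x := by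
  obtain ⟨g, hg⟩ := hG (Equiv.swap a b * Equiv.swap b c)
    (by rw [Equiv.Perm.sign_mul, Equiv.Perm.sign_swap hab, Equiv.Perm.sign_swap hbc]; rfl)
  refine ⟨g, ?_, ?_, ?_, fun x h1 h2 h3 => ?_⟩ <;> rw [hg, Equiv.Perm.mul_apply] <;>
    grind

omit [Fintype X] [DecidableEq X] in
theorem exists_perm_of_injective {n : ℕ} {u v : Fin n → X} (hu : Function.Injective u)
    (hv : Function.Injective v) : ∃ σ : Equiv.Perm X, ∀ i, σ (u i) = v i := by
  have := Equiv.Perm.isMultiplyPretransitive X n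
  obtain ⟨σ, hσ⟩ := MulAction.exists_smul_eq (Equiv.Perm X) (⟨u, hu⟩ : Fin n ↪ X) ⟨v, hv⟩
  exact ⟨σ, fun i => DFunLike.congr_fun hσ i⟩

theorem InducesEven.exists_quadruple (hG : InducesEven G X) {u v : Fin 4 → X}
    (hu : Function.Injective u) (hv : Function.Injective v) :
    ∃ g : G, g • u 0 = v 0 ∧ g • u 1 = v 1 ∧
      ((g • u 2 = v 2 ∧ g • u 3 = v 3) ∨ (g • u 2 = v 3 ∧ g • u 3 = v 2)) := by
  obtain ⟨σ, hσ⟩ := exists_perm_of_injective hu hv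
  have hne : ∀ i j, i ≠ j → u i ≠ u j := fun i j h => hu.ne h
  rcases Int.units_eq_one_or (Equiv.Perm.sign σ) with h | h
  · obtain ⟨g, hg⟩ := hG σ h
    exact ⟨g, by simp [hg, hσ]⟩
  · obtain ⟨g, hg⟩ := hG (σ * Equiv.swap (u 2) (u 3)) (by
      rw [Equiv.Perm.sign_mul, h, Equiv.Perm.sign_swap (hne 2 3 (by decide))]; rfl)
    refine ⟨g, ?_, ?_, Or.inr ⟨?_, ?_⟩⟩ <;> rw [hg, Equiv.Perm.mul_apply]
    · rw [Equiv.swap_apply_of_ne_of_ne (hne 0 2 (by decide)) (hne 0 3 (by decide)), hσ]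
    · rw [Equiv.swap_apply_of_ne_of_ne (hne 1 2 (by decide)) (hne 1 3 (by decide)), hσ]
    · rw [Equiv.swap_apply_left, hσ]
    · rw [Equiv.swap_apply_right, hσ]

theorem InducesEven.exists_triple (hG : InducesEven G X) (hX : 5 ≤ Fintype.card X) {u v : Fin 3 → X}
    (hu : Function.Injective u) (hv : Function.Injective v) :
    ∃ g : G, ∀ i, g • u i = v i := by
  obtain ⟨σ, hσ⟩ := exists_perm_of_injective hu hv
  rcases Int.units_eq_one_or (Equiv.Perm.sign σ) with h | h
  · obtain ⟨g, hg⟩ := hG σ h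
    exact ⟨g, by simp [hg, hσ]⟩
  · have hc : (Finset.univ.image u).card ≤ 3 := Finset.card_image_le
    obtain ⟨p, hp⟩ := exists_notMem_of_card_lt (Finset.univ.image u) (by omega)
    obtain ⟨q, hq⟩ := exists_notMem_of_card_lt (insert p (Finset.univ.image u)) (by
      have := Finset.card_insert_le p (Finset.univ.image u)
      omega)
    simp only [Finset.mem_insert, Finset.mem_image, Finset.mem_univ, true_and, not_or,
      not_exists] at hp hq
    obtain ⟨g, hg⟩ := hG (σ * Equiv.swap p q) (by
      rw [Equiv.Perm.sign_mul, h, Equiv.Perm.sign_swap (Ne.symm hq.1)]; rfl)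
    refine ⟨g, fun i => ?_⟩
    rw [hg, Equiv.Perm.mul_apply, Equiv.swap_apply_of_ne_of_ne (hp i) (hq.2 i), hσ]

theorem finrank_add_card_mul_le {V Z M : Type} [AddCommGroup V] [Module F V] [AddCommGroup Z]
    [Module F Z] [AddCommGroup M] [Module F M] [FiniteDimensional F M] [FiniteDimensional F V]
    [FiniteDimensional F Z] (s : Finset X)
    (L : V × (X → Z) →ₗ[F] M)
    (hL : ∀ v φ, (∀ i, i ∉ s → φ i = 0) → L (v, φ) = 0 → v = 0 ∧ φ = 0) :
    finrank F V + s.card * finrank F Z ≤ finrank F M := by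
  let E : (s → Z) →ₗ[F] (X → Z) :=
    { toFun φ i := if h : i ∈ s then φ ⟨i, h⟩ else 0
      map_add' a b := by ext i; by_cases h : i ∈ s <;> simp [h]
      map_smul' c a := by ext i; by_cases h : i ∈ s <;> simp [h] }
  have hE (φ : s → Z) (i : s) : E φ i = φ i := dif_pos i.2
  have hE2 (φ : s → Z) (i : X) (hi : i ∉ s) : E φ i = 0 := dif_neg hi
  have := LinearMap.finrank_le_finrank_of_injective (f := L ∘ₗ LinearMap.prodMap LinearMap.id E) (by
    rw [injective_iff_map_eq_zero]
    rintro ⟨v, φ⟩ h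
    obtain ⟨h1, h2⟩ := hL v (E φ) (hE2 φ) h
    refine Prod.ext h1 (funext fun i => ?_)
    exact (hE φ i).symm.trans (congrFun h2 i))
  simpa [finrank_prod, finrank_pi_fintype] using this

end Permutations

section Transitivity

variable {G X : Type} [Group G] [MulAction G X] [Fintype X] [DecidableEq X]

omit [Fintype X] [DecidableEq X] in
theorem injective_vec_three {a b c : X} (hab : a ≠ b) (hac : a ≠ c) (hbc : b ≠ c) :
    Function.Injective ![a, b, c] := by
  intro i j
  fin_cases i <;> fin_cases j <;> simp [hab, hac, hbc, hab.symm, hac.symm, hbc.symm]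

omit [Fintype X] [DecidableEq X] in
theorem injective_vec_four {a b c d : X} (hab : a ≠ b) (hac : a ≠ c) (had : a ≠ d) (hbc : b ≠ c)
    (hbd : b ≠ d) (hcd : c ≠ d) : Function.Injective ![a, b, c, d] := by
  intro i j
  fin_cases i <;> fin_cases j <;>
    simp [hab, hac, had, hbc, hbd, hcd, hab.symm, hac.symm, had.symm, hbc.symm, hbd.symm, hcd.symm]

theorem InducesEven.exists_smul_three (hG : InducesEven G X) (hX : 5 ≤ Fintype.card X)
    {a b c x y z : X} (hab : a ≠ b) (hac : a ≠ c) (hbc : b ≠ c) (hxy : x ≠ y) (hxz : x ≠ z)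
    (hyz : y ≠ z) : ∃ g : G, g • a = x ∧ g • b = y ∧ g • c = z := by
  obtain ⟨g, hg⟩ := hG.exists_triple hX (injective_vec_three hab hac hbc)
    (injective_vec_three hxy hxz hyz)
  exact ⟨g, hg 0, hg 1, hg 2⟩

end Transitivity

section Estimates

variable {F G X M : Type} [Field F] [Group G] [MulAction G X] [Fintype X] [DecidableEq X]
  [AddCommGroup M] [Module F M] {ρ : Representation F G M}

theorem eq_zero_of_eq_neg_self [NeZero (2 : F)] {m : M} (h : m = -m) : m = 0 := by
  rw [eq_neg_iff_add_eq_zero, ← two_smul F] at h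
  exact (smul_eq_zero.1 h).resolve_left (NeZero.ne _)

theorem diffRep_eq_zero_of_apply_eq_zero (hG : InducesEven G X) (hX : 5 ≤ Fintype.card X)
    {f : diffSub F M X} (hf : f ∈ (diffRep ρ X).invariants) {a b : X} (hab : a ≠ b)
    (h : f.1 a b = 0) : f = 0 := by
  ext x y
  change f.1 x y = 0
  by_cases hxy : x = y
  · rw [hxy, diffSub_self]
  have h2 := Finset.card_le_two (a := a) (b := b)
  have h3 := Finset.card_le_two (a := x) (b := y)
  obtain ⟨c, hc⟩ := exists_notMem_of_card_lt {a, b} (by omega)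
  obtain ⟨z, hz⟩ := exists_notMem_of_card_lt {x, y} (by omega)
  simp only [Finset.mem_insert, Finset.mem_singleton, not_or] at hc hz
  obtain ⟨g, rfl, rfl, -⟩ := hG.exists_smul_three hX hab (Ne.symm hc.1) (Ne.symm hc.2) hxy
    (Ne.symm hz.1) (Ne.symm hz.2)
  rw [← mem_invariants_diffRep hf, h, map_zero]

section Alternating

variable [NeZero (2 : F)] {f : X → X → X → M} (hf : f ∈ altSub ρ X)
include hf

omit [NeZero (2 : F)] [Fintype X] [DecidableEq X] in
theorem altSub_rotate (x y z : X) : f x y z = f y z x := by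
  rw [hf.1, hf.2.1, neg_neg]

omit [Fintype X] [DecidableEq X] in
theorem altSub_eq_zero_of_not_distinct {x y z : X} (h : x = y ∨ x = z ∨ y = z) : f x y z = 0 := by
  have key (x y : X) : f x x y = 0 := eq_zero_of_eq_neg_self (F := F) (hf.1 x x y)
  rcases h with rfl | rfl | rfl
  · exact key _ _
  · rw [← altSub_rotate hf]; exact key _ _
  · rw [altSub_rotate hf]; exact key _ _

theorem altSub_eq_zero_of_apply_eq_zero (hG : InducesEven G X) (hX : 5 ≤ Fintype.card X)
    {a b c : X} (hab : a ≠ b) (hac : a ≠ c) (hbc : b ≠ c) (h : f a b c = 0) : f = 0 := by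
  ext x y z
  by_cases hxyz : x = y ∨ x = z ∨ y = z
  · exact altSub_eq_zero_of_not_distinct hf hxyz
  simp only [not_or] at hxyz
  obtain ⟨g, rfl, rfl, rfl⟩ := hG.exists_smul_three hX hab hac hbc hxyz.1 hxyz.2.1 hxyz.2.2
  rw [← hf.2.2.2, h, map_zero]
  rfl

theorem altSub_eq_zero_of_apply_eq_apply (hG : InducesEven G X) (hX : 5 ≤ Fintype.card X)
    {a b c d : X} (hab : a ≠ b) (hac : a ≠ c) (had : a ≠ d) (hbc : b ≠ c)
    (hbd : b ≠ d) (hcd : c ≠ d) (h : f a b c = f a b d) : f = 0 := by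
  have key {x y z w : X} (hxy : x ≠ y) (hxz : x ≠ z) (hxw : x ≠ w) (hyz : y ≠ z) (hyw : y ≠ w)
      (hzw : z ≠ w) : f x y z = f x y w := by
    obtain ⟨g, rfl, rfl, h' | h'⟩ := hG.exists_quadruple
      (injective_vec_four hab hac had hbc hbd hcd) (injective_vec_four hxy hxz hxw hyz hyw hzw)
    · obtain ⟨rfl, rfl⟩ := h'
      change f (g • a) (g • b) (g • c) = f (g • a) (g • b) (g • d)
      rw [← hf.2.2.2, ← hf.2.2.2, h]
    · obtain ⟨rfl, rfl⟩ := h'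
      change f (g • a) (g • b) (g • d) = f (g • a) (g • b) (g • c)
      rw [← hf.2.2.2, ← hf.2.2.2, h]
  refine altSub_eq_zero_of_apply_eq_zero hf hG hX hab hac hbc
    (eq_zero_of_eq_neg_self (F := F) ?_)
  calc
    f a b c = f b c a := altSub_rotate hf _ _ _
    _ = f b c d := key hbc hab.symm hbd hac.symm hcd had
    _ = f c d b := altSub_rotate hf _ _ _
    _ = f c d a := key hcd hbc.symm hac.symm hbd.symm had.symm hab.symm
    _ = f a c d := (altSub_rotate hf _ _ _).symm
    _ = f a c b := key hac had hab hcd hbc.symm hbd.symm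
    _ = -f a b c := hf.2.1 _ _ _

end Alternating

end Estimates

section FirstEstimate

variable {F G X M : Type} [Field F] [Group G] [MulAction G X] [Fintype X] [DecidableEq X]
  [AddCommGroup M] [Module F M] {ρ : Representation F G M}

omit [DecidableEq X] in
theorem sum_diffRep_eq_zero {φ : X → diffSub F M X}
    (hφ : ∀ i, φ i ∈ (diffRep ρ X).invariants) (v : ρ.invariants) {m : X}
    (h : v.1 + ∑ i, (φ i).1 i m = 0) {g : G} (hg : g • m = m) :
    ∑ i, (φ i).1 i (g • i) = 0 := by
  have h2 := congrArg (ρ g) h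
  simp only [map_add, map_zero, map_sum, mem_invariants_diffRep (hφ _), hg] at h2
  rw [v.2 g, ← h, add_left_cancel_iff] at h2
  rw [← sub_self (∑ i, (φ i).1 i m)]
  nth_rewrite 2 [← h2]
  rw [← Finset.sum_sub_distrib]
  refine Finset.sum_congr rfl fun i _ => ?_
  rw [eq_sub_iff_add_eq, (φ i).2]

theorem idim_add_mul_finrank_le_of_injective [NeZero (2 : F)] [FiniteDimensional F M]
    (hG : InducesEven G X) (hX : 5 ≤ Fintype.card X) {Z : Type} [AddCommGroup Z] [Module F Z]
    [FiniteDimensional F Z] (j : Z →ₗ[F] diffSub F M X) (hj : Function.Injective j)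
    (hZ : ∀ z, j z ∈ (diffRep ρ X).invariants) :
    idim ρ + (Fintype.card X - 2) * finrank F Z ≤ finrank F M := by
  obtain ⟨z, m, hzm⟩ := Fintype.one_lt_card_iff.1 (by omega : 1 < Fintype.card X)
  have hs : (Finset.univ \ {z, m} : Finset X).card = Fintype.card X - 2 := by
    rw [Finset.card_sdiff_of_subset (Finset.subset_univ _), Finset.card_pair hzm,
      Finset.card_univ]
  let L : ρ.invariants × (X → Z) →ₗ[F] M :=
    { toFun p := p.1.1 + ∑ i, (j (p.2 i)).1 i m
      map_add' p q := by
        simp [Finset.sum_add_distrib]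
        abel
      map_smul' c p := by simp [Finset.smul_sum] }
  rw [← hs]
  refine finrank_add_card_mul_le _ L fun v φ hφ (hL : v.1 + ∑ i, (j (φ i)).1 i m = 0) => ?_
  have hz : φ z = 0 := hφ _ (by simp)
  have hm : φ m = 0 := hφ _ (by simp)
  suffices hφ0 : φ = 0 by
    refine ⟨?_, hφ0⟩
    ext
    simpa [hφ0] using hL
  ext1 c
  by_cases hcz : c = z
  · rw [hcz, hz]; rfl
  by_cases hcm : c = m
  · rw [hcm, hm]; rfl
  obtain ⟨a, ha⟩ := exists_notMem_of_card_lt {c, z, m} (Finset.card_le_three.trans_lt (by omega))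
  obtain ⟨b, hb⟩ := exists_notMem_of_card_lt {a, c, z, m} (Finset.card_le_four.trans_lt (by omega))
  simp only [Finset.mem_insert, Finset.mem_singleton, not_or] at ha hb
  obtain ⟨hac, haz, ham⟩ := ha
  obtain ⟨hba, hbc, hbz, hbm⟩ := hb
  have hf := (hZ (φ c))
  have h1 : ((j (φ a)).1 a b - (j (φ b)).1 a b) + (j (φ c)).1 c z = 0 := by
    obtain ⟨g, ga, gb, gc, gz, gx⟩ := hG.exists_double_swap (Ne.symm hba) hac haz hbc hbz hcz
    have h := sum_diffRep_eq_zero (fun i => hZ (φ i)) v hL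
      (gx m (Ne.symm ham) (Ne.symm hbm) (Ne.symm hcm)
      (Ne.symm hzm))
    rw [← Finset.sum_subset (Finset.subset_univ {a, b, c}),
      Finset.sum_insert (by simp [hac, Ne.symm hba]), Finset.sum_pair hbc, ga, gb, gc] at h
    · rw [← h, diffSub_symm (j (φ b)) b a]
      abel
    · intro x _ hx
      simp only [Finset.mem_insert, Finset.mem_singleton, not_or] at hx
      by_cases hxz : x = z
      · rw [hxz, hz, map_zero]; rfl
      · rw [gx x hx.1 hx.2.1 hx.2.2 hxz, diffSub_self]
  have h2 : - ((j (φ a)).1 a b - (j (φ b)).1 a b) + (j (φ c)).1 c m = 0 := by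
    obtain ⟨g, ga, gb, gz, gm, gx⟩ := hG.exists_double_swap (Ne.symm hba) haz ham hbz hbm hzm
    have h := congrArg (ρ g) h1
    rw [map_add, map_sub, map_zero, mem_invariants_diffRep (hZ (φ a)),
      mem_invariants_diffRep (hZ (φ b)),
      mem_invariants_diffRep hf, ga, gb, gz, gx c (Ne.symm hac) (Ne.symm hbc) hcz hcm] at h
    rw [← h, diffSub_symm (j (φ a)) a b, diffSub_symm (j (φ b)) a b]
    abel
  have h3 : (j (φ c)).1 c z + (j (φ c)).1 c m = 0 := by
    rw [← add_zero (0 : M)]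
    nth_rewrite 1 [← h1]
    rw [← h2]
    abel
  have h4 {x y : X} (hcx : c ≠ x) (hcy : c ≠ y) (hxy : x ≠ y) :
      (j (φ c)).1 c x = - (j (φ c)).1 c y := by
    obtain ⟨g, gc, rfl, rfl⟩ := hG.exists_smul_three hX hcz hcm hzm hcx hcy hxy
    have h := congrArg (ρ g) h3
    rwa [map_add, map_zero, mem_invariants_diffRep hf, mem_invariants_diffRep hf, gc,
      ← eq_neg_iff_add_eq_zero] at h
  refine hj ((diffRep_eq_zero_of_apply_eq_zero hG hX hf hcz
    (eq_zero_of_eq_neg_self (F := F) ?_)).trans (map_zero j).symm)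
  rw [← h4 hcm hcz (Ne.symm hzm), h4 hcz (Ne.symm hac) (Ne.symm haz),
    h4 hcm (Ne.symm hac) (Ne.symm ham)]

theorem idim_add_mul_idim_diffRep_le [NeZero (2 : F)] [FiniteDimensional F M]
    (hG : InducesEven G X) (hX : 5 ≤ Fintype.card X) :
    idim ρ + (Fintype.card X - 2) * idim (diffRep ρ X) ≤ finrank F M :=
  @idim_add_mul_finrank_le_of_injective F G X M _ _ _ _ _ _ _ ρ _ _ hG hX (diffRep ρ X).invariants
    (Submodule.addCommGroup _) (Submodule.module _) inferInstance
    (Submodule.subtype _) Subtype.val_injective fun z => z.2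

end FirstEstimate

section SecondEstimate

variable {F G X M : Type} [Field F] [Group G] [MulAction G X] [Fintype X] [DecidableEq X]
  [AddCommGroup M] [Module F M] {ρ : Representation F G M}

theorem sum_altSub_sub [NeZero (2 : F)] {φ : X → X → X → X → M} (hφ : ∀ i, φ i ∈ altSub ρ X)
    {o u x y : X} (hxy : x ≠ y) {g : G} (gx : g • x = y) (gy : g • y = x)
    (hg : ∀ i, i ≠ o → i ≠ u → i ≠ x → i ≠ y → g • i = i) (go : g • o = u) (gu : g • u = o) :
    ∑ i, φ i o u i - ∑ i, φ i o u (g • i) =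
      (φ x o u x - φ y o u x) - (φ x o u y - φ y o u y) := by
  rw [← Finset.sum_sub_distrib, ← Finset.sum_subset (Finset.subset_univ {x, y}),
    Finset.sum_pair hxy, gx, gy]
  · abel
  · intro i _ hi
    simp only [Finset.mem_insert, Finset.mem_singleton, not_or] at hi
    have h0 {a b c : X} (h : a = b ∨ a = c ∨ b = c) : φ i a b c = 0 :=
      altSub_eq_zero_of_not_distinct (hφ i) h
    by_cases hio : i = o
    · rw [h0 (by simp [hio]), h0 (by simp [hio, go]), sub_zero]
    by_cases hiu : i = u
    · rw [h0 (by simp [hiu]), h0 (by simp [hiu, gu]), sub_zero]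
    rw [hg i hio hiu hi.1 hi.2, sub_self]

theorem altSub_double_swap [NeZero (2 : F)] (hG : InducesEven G X) {φ : X → X → X → X → M}
    (hφ : ∀ i, φ i ∈ altSub ρ X) (v : ρ.invariants) {ψ : X → X → X → M} (hψ : ψ ∈ altSub ρ X)
    {o u a b w : X} (h : v.1 + ψ a b w + ∑ i, φ i o u i = 0) {x y : X} (hou : o ≠ u)
    (hxy : x ≠ y) (hox : o ≠ x) (hoy : o ≠ y) (hux : u ≠ x) (huy : u ≠ y) :
    ∃ g : G, g • x = y ∧ g • y = x ∧ (∀ i, i ≠ o → i ≠ u → i ≠ x → i ≠ y → g • i = i) ∧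
      v.1 + v.1 + ψ a b w + ψ (g • a) (g • b) (g • w) +
        ((φ x o u x - φ y o u x) - (φ x o u y - φ y o u y)) = 0 := by
  obtain ⟨g, go, gu, gx, gy, hg⟩ := hG.exists_double_swap hou hox hoy hux huy hxy
  refine ⟨g, gx, gy, hg, ?_⟩
  rw [← sum_altSub_sub hφ hxy gx gy hg go gu]
  have h2 := congrArg (ρ g) h
  simp only [map_add, map_zero, map_sum, (hφ _).2.2.2, hψ.2.2.2, v.2 g, go, gu] at h2
  simp only [(hφ _).1 u o, Finset.sum_neg_distrib] at h2
  rw [← add_zero (0 : M)]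
  nth_rewrite 1 [← h]
  rw [← h2]
  abel

theorem eq_zero_and_altSub_eq_zero [NeZero (2 : F)] [NeZero (3 : F)] (hG : InducesEven G X)
    (hX : 5 ≤ Fintype.card X) (v : ρ.invariants) {f : X → X → X → M} (hf : f ∈ altSub ρ X)
    {o u a b w : X} (hou : o ≠ u) (hoa : o ≠ a) (hob : o ≠ b) (how : o ≠ w) (hua : u ≠ a)
    (hub : u ≠ b) (huw : u ≠ w) (hab : a ≠ b) (haw : a ≠ w) (hbw : b ≠ w)
    (h : v.1 + v.1 + (f o u a - f o u w) = 0) : v = 0 ∧ f = 0 := by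
  obtain ⟨g, ga, gb, gw, hg⟩ := hG.exists_cycle hab haw hbw
  have h2 := congrArg (ρ g) h
  simp only [map_add, map_sub, map_zero, v.2 g, hf.2.2.2, ga, gw, hg o hoa hob how,
    hg u hua hub huw] at h2
  have h3 := congrArg (ρ g) h2
  simp only [map_add, map_sub, map_zero, v.2 g, hf.2.2.2, ga, gb, hg o hoa hob how,
    hg u hua hub huw] at h3
  have h4 : v.1 = 0 := by
    have : (2 : F) • (3 : F) • v.1 = 0 := by
      have h5 : v.1 + v.1 + (f o u a - f o u w) + (v.1 + v.1 + (f o u b - f o u a)) +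
        (v.1 + v.1 + (f o u w - f o u b)) = 0 := by rw [h, h2, h3]; simp
      rw [← h5]
      module
    exact (smul_eq_zero_iff_right (NeZero.ne _)).1 ((smul_eq_zero_iff_right (NeZero.ne _)).1 this)
  rw [h4, add_zero, zero_add, sub_eq_zero] at h
  exact ⟨Subtype.ext h4, altSub_eq_zero_of_apply_eq_apply hf hG hX hou hoa how hua huw haw h⟩

theorem altSub_eq_zero_of_sub_add_eq_zero [NeZero (2 : F)] [NeZero (3 : F)]
    (hG : InducesEven G X) (hX : 7 ≤ Fintype.card X) {f ψ : X → X → X → M} (hf : f ∈ altSub ρ X)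
    (hψ : ψ ∈ altSub ρ X) {o u a b w c : X} (hou : o ≠ u) (hoa : o ≠ a) (hob : o ≠ b)
    (how : o ≠ w) (hua : u ≠ a) (hub : u ≠ b) (huw : u ≠ w) (hab : a ≠ b)
    (hco : c ≠ o) (hcu : c ≠ u) (h : ψ c b w - ψ a c w + (f o u b - f o u a) = 0) : f = 0 := by
  obtain ⟨d, hd⟩ := exists_notMem_of_card_lt {o, u, a, b, w, c}
    (Finset.card_le_six.trans_lt (by omega))
  simp only [Finset.mem_insert, Finset.mem_singleton, not_or] at hd
  obtain ⟨hdo, hdu, hda, hdb, hdw, hdc⟩ := hd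
  obtain ⟨g, go, gu, gd, hg⟩ := hG.exists_cycle hou (Ne.symm hdo) (Ne.symm hdu)
  have gc := hg c hco hcu (Ne.symm hdc)
  have ga := hg a (Ne.symm hoa) (Ne.symm hua) (Ne.symm hda)
  have gb := hg b (Ne.symm hob) (Ne.symm hub) (Ne.symm hdb)
  have gw := hg w (Ne.symm how) (Ne.symm huw) (Ne.symm hdw)
  have h2 := congrArg (ρ g) h
  simp only [map_add, map_sub, map_zero, hf.2.2.2, hψ.2.2.2, go, gu, gc, ga, gb, gw] at h2
  have h3 := congrArg (ρ g) h2
  simp only [map_add, map_sub, map_zero, hf.2.2.2, hψ.2.2.2, gd, gu, gc, ga, gb, gw] at h3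
  have h4 : ψ c b w - ψ a c w = 0 := by
    refine (smul_eq_zero_iff_right (NeZero.ne (3 : F))).1 ?_
    have e1 := hf.2.2.1 o u d b
    have e2 := hf.2.2.1 o u d a
    rw [hf.1 o d] at e1 e2
    have e3 : (ψ c b w - ψ a c w + (f o u b - f o u a)) +
      (ψ c b w - ψ a c w + (f u d b - f u d a)) +
      (ψ c b w - ψ a c w + (f d o b - f d o a)) = 0 := by rw [h, h2, h3]; simp
    linear_combination (norm := module) e3 - e1 + e2
  rw [h4, zero_add, sub_eq_zero] at h
  exact altSub_eq_zero_of_apply_eq_apply hf hG (by omega) hou hob hoa hub hua (Ne.symm hab) h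

theorem idim_add_mul_finrank_altSub_le [NeZero (2 : F)] [NeZero (3 : F)] [FiniteDimensional F M]
    (hG : InducesEven G X) (hX : 5 ≤ Fintype.card X) (hX6 : Fintype.card X ≠ 6) :
    idim ρ + (Fintype.card X - 2) * finrank F (altSub ρ X) ≤ finrank F M := by
  obtain ⟨e⟩ : Nonempty (Fin 5 ↪ X) := Function.Embedding.nonempty_of_card_le (by simpa using hX)
  have he {i j : Fin 5} (h : i ≠ j) : e i ≠ e j := e.injective.ne h
  have hs : (Finset.univ \ {e 0, e 1, e 4} : Finset X).card = Fintype.card X - 3 := by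
    rw [Finset.card_sdiff_of_subset (Finset.subset_univ _), Finset.card_univ,
      Finset.card_eq_three.2 ⟨_, _, _, he (by decide), he (by decide), he (by decide), rfl⟩]
  let L : (ρ.invariants × altSub ρ X) × (X → altSub ρ X) →ₗ[F] M :=
    { toFun p := p.1.1.1 + p.1.2.1 (e 2) (e 3) (e 4) + ∑ i, (p.2 i).1 (e 0) (e 1) i
      map_add' p q := by
        simp [Finset.sum_add_distrib]
        abel
      map_smul' c p := by simp [Finset.smul_sum] }
  suffices h : finrank F (ρ.invariants × altSub ρ X) +
      (Fintype.card X - 3) * finrank F (altSub ρ X) ≤ finrank F M by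
    rw [finrank_prod] at h
    obtain ⟨k, hk⟩ := Nat.exists_eq_add_of_le hX
    rw [hk] at h ⊢
    simp only [show 5 + k - 3 = k + 2 by omega,
      show 5 + k - 2 = k + 3 by omega] at h ⊢
    change idim ρ + _ + _ ≤ _ at h
    linarith
  rw [← hs]
  refine finrank_add_card_mul_le _ L ?_
  rintro ⟨v, ψ⟩ φ hφ (hL : v.1 + ψ.1 (e 2) (e 3) (e 4) + ∑ i, (φ i).1 (e 0) (e 1) i = 0)
  have h0 : φ (e 0) = 0 := hφ _ (by simp)
  have h1 : φ (e 1) = 0 := hφ _ (by simp)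
  have h4 : φ (e 4) = 0 := hφ _ (by simp)
  have key (x y : X) := altSub_double_swap hG (fun i => (φ i).2) v ψ.2 hL (x := x) (y := y)
    (he (by decide))
  obtain ⟨hv, h2⟩ : v = 0 ∧ (φ (e 2)).1 = 0 := by
    obtain ⟨g, gx, gy, hg, h⟩ := key (e 2) (e 4) (he (by decide)) (he (by decide))
      (he (by decide)) (he (by decide)) (he (by decide))
    rw [gx, gy, hg (e 3) (he (by decide)) (he (by decide)) (he (by decide)) (he (by decide)), h4,
      ψ.2.2.1 (e 4), altSub_rotate ψ.2 (e 4)] at h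
    refine eq_zero_and_altSub_eq_zero hG hX v (φ (e 2)).2 (o := e 0) (u := e 1) (a := e 2)
      (b := e 3) (w := e 4) ?_ ?_ ?_ ?_ ?_ ?_ ?_ ?_ ?_ ?_ ?_
    rotate_right
    · rw [← h]
      simp
    all_goals exact he (by decide)
  have h3 : (φ (e 3)).1 = 0 := by
    obtain ⟨g, gx, gy, hg, h⟩ := key (e 3) (e 4) (he (by decide)) (he (by decide))
      (he (by decide)) (he (by decide)) (he (by decide))
    rw [gx, gy, hg (e 2) (he (by decide)) (he (by decide)) (he (by decide)) (he (by decide)), h4,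
      ψ.2.2.1 (e 2) (e 4)] at h
    refine (eq_zero_and_altSub_eq_zero hG hX v (φ (e 3)).2 (o := e 0) (u := e 1) (a := e 3)
      (b := e 2) (w := e 4) ?_ ?_ ?_ ?_ ?_ ?_ ?_ ?_ ?_ ?_ ?_).2
    rotate_right
    · rw [← h]
      simp
    all_goals exact he (by decide)
  subst hv
  have hφ0 : φ = 0 := by
    ext1 c
    by_cases hc : c ∈ ({e 0, e 1, e 2, e 3, e 4} : Finset X)
    · simp only [Finset.mem_insert, Finset.mem_singleton] at hc
      rcases hc with rfl | rfl | rfl | rfl | rfl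
      exacts [h0, h1, Subtype.ext h2, Subtype.ext h3, h4]
    have hX7 : 7 ≤ Fintype.card X := by
      by_contra hlt
      have h5 : Fintype.card X = 5 := by omega
      refine hc ?_
      obtain ⟨i, rfl⟩ := ((Fintype.bijective_iff_injective_and_card e).2
        ⟨e.injective, by simp [h5]⟩).2 c
      fin_cases i <;> simp
    simp only [Finset.mem_insert, Finset.mem_singleton, not_or] at hc
    obtain ⟨c0, c1, c2, c3, c4⟩ := hc
    obtain ⟨g, gx, gy, hg, h⟩ := key c (e 2) c2 (Ne.symm c0) (he (by decide))
      (Ne.symm c1) (he (by decide))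
    obtain ⟨g', gx', gy', hg', h'⟩ := key c (e 3) c3 (Ne.symm c0) (he (by decide))
      (Ne.symm c1) (he (by decide))
    rw [gy, hg (e 3) (he (by decide)) (he (by decide)) (Ne.symm c3) (he (by decide)),
      hg (e 4) (he (by decide)) (he (by decide)) (Ne.symm c4) (he (by decide)), h2] at h
    rw [gy', hg' (e 2) (he (by decide)) (he (by decide)) (Ne.symm c2) (he (by decide)),
      hg' (e 4) (he (by decide)) (he (by decide)) (Ne.symm c4) (he (by decide)), h3] at h'
    refine Subtype.ext (altSub_eq_zero_of_sub_add_eq_zero hG hX7 (φ c).2 ψ.2 (o := e 0)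
      (u := e 1) (a := e 2) (b := e 3) (w := e 4) (c := c) ?_ ?_ ?_ ?_ ?_ ?_ ?_ ?_ c0 c1 ?_)
    rotate_right
    · rw [← sub_eq_zero.2 (h.trans h'.symm)]
      simp only [Pi.zero_apply, sub_zero]
      abel
    all_goals exact he (by decide)
  refine ⟨Prod.ext rfl (Subtype.ext ?_), hφ0⟩
  refine altSub_eq_zero_of_apply_eq_zero ψ.2 hG hX (a := e 2) (b := e 3) (c := e 4) (he (by decide))
    (he (by decide)) (he (by decide)) ?_
  simpa [hφ0] using hL

end SecondEstimate

section ThirdEstimate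

variable {F X M : Type} [Field F] [Fintype X] [DecidableEq X]
  [AddCommGroup M] [Module F M] {ρ : Representation F (Equiv.Perm X) M}

theorem inducesEven_perm : InducesEven (Equiv.Perm X) X := fun σ _ => ⟨σ, fun _ => rfl⟩

theorem idim_add_finrank_add_mul_finrank_altSub_le_of_injective [NeZero (2 : F)]
    [FiniteDimensional F M] (hX : 5 ≤ Fintype.card X) {Z : Type} [AddCommGroup Z] [Module F Z]
    [FiniteDimensional F Z] (j : Z →ₗ[F] diffSub F M X) (hj : Function.Injective j)
    (hZ : ∀ z, j z ∈ (diffRep ρ X).invariants) :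
    idim ρ + finrank F Z + (Fintype.card X - 2) * finrank F (altSub ρ X) ≤ finrank F M := by
  have hG : InducesEven (Equiv.Perm X) X := inducesEven_perm
  obtain ⟨e⟩ : Nonempty (Fin 5 ↪ X) := Function.Embedding.nonempty_of_card_le (by simpa using hX)
  have he {i j : Fin 5} (h : i ≠ j) : e i ≠ e j := e.injective.ne h
  have hs : (Finset.univ \ {e 0, e 1, e 4} : Finset X).card = Fintype.card X - 3 := by
    rw [Finset.card_sdiff_of_subset (Finset.subset_univ _), Finset.card_univ,
      Finset.card_eq_three.2 ⟨_, _, _, he (by decide), he (by decide), he (by decide), rfl⟩]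
  let L : ((ρ.invariants × Z) × altSub ρ X) × (X → altSub ρ X) →ₗ[F] M :=
    { toFun p := p.1.1.1.1 + (j p.1.1.2).1 (e 0) (e 1) + p.1.2.1 (e 2) (e 3) (e 4) +
        ∑ i, (p.2 i).1 (e 0) (e 1) i
      map_add' p q := by
        simp [Finset.sum_add_distrib]
        abel
      map_smul' c p := by simp [Finset.smul_sum] }
  suffices h : finrank F ((ρ.invariants × Z) × altSub ρ X) +
      (Fintype.card X - 3) * finrank F (altSub ρ X) ≤ finrank F M by
    rw [finrank_prod, finrank_prod] at h
    obtain ⟨k, hk⟩ := Nat.exists_eq_add_of_le hX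
    rw [hk] at h ⊢
    simp only [show 5 + k - 3 = k + 2 by omega, show 5 + k - 2 = k + 3 by omega] at h ⊢
    change idim ρ + _ + _ + _ ≤ _ at h
    linarith
  rw [← hs]
  refine finrank_add_card_mul_le _ L ?_
  rintro ⟨⟨v, z⟩, ψ⟩ φ hφ (hL : v.1 + (j z).1 (e 0) (e 1) + ψ.1 (e 2) (e 3) (e 4) +
    ∑ i, (φ i).1 (e 0) (e 1) i = 0)
  have h0 : φ (e 0) = 0 := hφ _ (by simp)
  have h1 : φ (e 1) = 0 := hφ _ (by simp)
  have h4 : φ (e 4) = 0 := hφ _ (by simp)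
  have h2F : (2 : F) ≠ 0 := NeZero.ne _
  have ha : v.1 + ψ.1 (e 2) (e 3) (e 4) = 0 := by
    have h := congrArg (ρ (Equiv.swap (e 0) (e 1))) hL
    have hfix (i : Fin 5) (hi0 : i ≠ 0) (hi1 : i ≠ 1) : Equiv.swap (e 0) (e 1) (e i) = e i :=
      Equiv.swap_apply_of_ne_of_ne (he hi0) (he hi1)
    simp only [map_add, map_zero, map_sum, v.2 _, (φ _).2.2.2.2, ψ.2.2.2.2,
      mem_invariants_diffRep (hZ z), Equiv.Perm.smul_def, hfix 2 (by decide) (by decide),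
      hfix 3 (by decide) (by decide), hfix 4 (by decide) (by decide), Equiv.swap_apply_left,
      Equiv.swap_apply_right] at h
    have hsum : ∑ i, (φ i).1 (e 1) (e 0) (Equiv.swap (e 0) (e 1) i) =
        - ∑ i, (φ i).1 (e 0) (e 1) i := by
      rw [← Finset.sum_neg_distrib]
      refine Finset.sum_congr rfl fun i _ => ?_
      by_cases hi0 : i = e 0
      · rw [hi0, h0]; simp
      by_cases hi1 : i = e 1
      · rw [hi1, h1]; simp
      rw [Equiv.swap_apply_of_ne_of_ne hi0 hi1, (φ i).2.1]
    rw [hsum, diffSub_symm (j z)] at h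
    refine (smul_eq_zero_iff_right h2F).1 ?_
    linear_combination (norm := module) hL + h
  obtain ⟨hv, hψ⟩ : v.1 = 0 ∧ ψ.1 (e 2) (e 3) (e 4) = 0 := by
    have h := congrArg (ρ (Equiv.swap (e 2) (e 3))) ha
    rw [map_add, map_zero, v.2, ψ.2.2.2.2, Equiv.Perm.smul_def, Equiv.Perm.smul_def,
      Equiv.Perm.smul_def, Equiv.swap_apply_left, Equiv.swap_apply_right,
      Equiv.swap_apply_of_ne_of_ne (he (by decide)) (he (by decide)), ψ.2.1] at h
    constructor <;> refine (smul_eq_zero_iff_right h2F).1 ?_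
    · linear_combination (norm := module) ha + h
    · linear_combination (norm := module) ha - h
  rw [hv, hψ, zero_add, add_zero] at hL
  have hφ0 : φ = 0 := by
    ext1 c
    by_cases c0 : c = e 0
    · rw [c0, h0]; rfl
    by_cases c1 : c = e 1
    · rw [c1, h1]; rfl
    by_cases c4 : c = e 4
    · rw [c4, h4]; rfl
    have h := congrArg (ρ (Equiv.swap c (e 4))) hL
    simp only [map_add, map_zero, map_sum, (φ _).2.2.2.2, mem_invariants_diffRep (hZ z),
      Equiv.Perm.smul_def,
      Equiv.swap_apply_of_ne_of_ne (Ne.symm c0) (he (by decide : (0 : Fin 5) ≠ 4)),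
      Equiv.swap_apply_of_ne_of_ne (Ne.symm c1) (he (by decide : (1 : Fin 5) ≠ 4))] at h
    have hsum : ∑ i, (φ i).1 (e 0) (e 1) i -
        ∑ i, (φ i).1 (e 0) (e 1) (Equiv.swap c (e 4) i) =
        (φ c).1 (e 0) (e 1) c - (φ c).1 (e 0) (e 1) (e 4) := by
      rw [← Finset.sum_sub_distrib, Finset.sum_eq_single c]
      · rw [Equiv.swap_apply_left]
      · intro i _ hi
        by_cases hi4 : i = e 4
        · rw [hi4, h4]; simp
        rw [Equiv.swap_apply_of_ne_of_ne hi hi4, sub_self]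
      · simp
    refine Subtype.ext (altSub_eq_zero_of_apply_eq_apply (φ c).2 hG hX
      (he (by decide : (0 : Fin 5) ≠ 1))
      (Ne.symm c0) (he (by decide : (0 : Fin 5) ≠ 4)) (Ne.symm c1)
      (he (by decide : (1 : Fin 5) ≠ 4)) c4 ?_)
    rw [← sub_eq_zero, ← hsum]
    linear_combination (norm := module) hL - h
  have hz : z = 0 := by
    refine hj ((diffRep_eq_zero_of_apply_eq_zero hG hX (hZ z)
      (he (by decide : (0 : Fin 5) ≠ 1)) ?_).trans
      (map_zero j).symm)
    simpa [hφ0] using hL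
  refine ⟨Prod.ext (Prod.ext (Subtype.ext hv) hz) (Subtype.ext ?_), hφ0⟩
  exact altSub_eq_zero_of_apply_eq_zero ψ.2 hG hX (he (by decide))
    (he (by decide)) (he (by decide)) hψ

theorem idim_add_idim_diffRep_add_mul_finrank_altSub_le [NeZero (2 : F)]
    [FiniteDimensional F M] (hX : 5 ≤ Fintype.card X) :
    idim ρ + idim (diffRep ρ X) + (Fintype.card X - 2) * finrank F (altSub ρ X) ≤ finrank F M :=
  @idim_add_finrank_add_mul_finrank_altSub_le_of_injective F X M _ _ _ _ _ ρ _ _ hX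
    (diffRep ρ X).invariants (Submodule.addCommGroup _) (Submodule.module _) inferInstance
    (Submodule.subtype _) Subtype.val_injective fun z => z.2

end ThirdEstimate

section PrimeDegree

variable {F G X : Type} [Field F] [Group G] [MulAction G X] [Fintype X] [DecidableEq X]

theorem InducesEven.isPretransitive (hG : InducesEven G X) (hX : 5 ≤ Fintype.card X) :
    MulAction.IsPretransitive G X where
  exists_smul_eq x y := by
    obtain ⟨a, ha⟩ := exists_notMem_of_card_lt {x, y} (Finset.card_le_two.trans_lt (by omega))
    obtain ⟨b, hb⟩ := exists_notMem_of_card_lt {a, x, y} (Finset.card_le_three.trans_lt (by omega))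
    simp only [Finset.mem_insert, Finset.mem_singleton, not_or] at ha hb
    obtain ⟨g, hg, -⟩ := hG.exists_smul_three hX (Ne.symm ha.1) (Ne.symm hb.2.1) (Ne.symm hb.1)
      (Ne.symm ha.2) (Ne.symm hb.2.2) (Ne.symm hb.1)
    exact ⟨g, hg⟩

omit [DecidableEq X] in
theorem hdim_one_le_idim_diffRep_and_hdim_two_le [NeZero (2 : F)] [Finite G]
    [MulAction.IsPretransitive G X] {x : X} (hx : (Nat.card (MulAction.stabilizer G x) : F) ≠ 0)
    {M : Type} [AddCommGroup M] [Module F M] [FiniteDimensional F M] (ρ : Representation F G M) :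
    hdim 1 ρ ≤ idim (diffRep ρ X) ∧ hdim 2 ρ ≤ finrank F (altSub ρ X) := by
  have : Nonempty X := ⟨x⟩
  exact ⟨hdim_one_le_diffRep (hdim_succ_funRep_of_isPretransitive x hx ρ 0),
    hdim_two_le_altSub (hdim_succ_funRep_of_isPretransitive x hx ρ)
      (hdim_succ_funRep_of_isPretransitive x hx (diffRep ρ X) 0)⟩

theorem InducesEven.weakBound [NeZero (2 : F)] [NeZero (3 : F)] [Finite G] (hG : InducesEven G X)
    (hX : 5 ≤ Fintype.card X) (hX6 : Fintype.card X ≠ 6) {x : X}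
    (hx : (Nat.card (MulAction.stabilizer G x) : F) ≠ 0) :
    WeakBound F G (Fintype.card X - 2) := by
  have := hG.isPretransitive hX
  refine ⟨fun M _ _ _ ρ => ?_, fun M _ _ _ ρ => ?_⟩
  · have h1 := Nat.mul_le_mul_left (Fintype.card X - 2)
      (hdim_one_le_idim_diffRep_and_hdim_two_le hx ρ).1
    have h2 := idim_add_mul_idim_diffRep_le (ρ := ρ) hG hX
    omega
  · have h1 := Nat.mul_le_mul_left (Fintype.card X - 2)
      (hdim_one_le_idim_diffRep_and_hdim_two_le hx ρ).2
    have h2 := idim_add_mul_finrank_altSub_le (ρ := ρ) hG hX hX6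
    omega

theorem strongBound_perm_of_card_stabilizer [NeZero (2 : F)] (hX : 5 ≤ Fintype.card X) {x : X}
    (hx : (Nat.card (MulAction.stabilizer (Equiv.Perm X) x) : F) ≠ 0) :
    StrongBound F (Equiv.Perm X) (Fintype.card X - 2) := by
  have hG := inducesEven_perm (X := X)
  have := hG.isPretransitive hX
  refine ⟨fun M _ _ _ ρ => ?_, fun M _ _ _ ρ => ?_⟩ <;>
    obtain ⟨h1, h2⟩ := hdim_one_le_idim_diffRep_and_hdim_two_le hx ρ
  · have h1 := Nat.mul_le_mul_left (Fintype.card X - 2) h1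
    have h3 := idim_add_mul_idim_diffRep_le (ρ := ρ) hG hX
    omega
  · have h2 := Nat.mul_le_mul_left (Fintype.card X - 2) h2
    have h3 := idim_add_idim_diffRep_add_mul_finrank_altSub_le (ρ := ρ) hX
    omega

variable (F) {p : ℕ} [CharP F p]

theorem natCast_ne_zero_of_dvd_factorial (hp : p.Prime) {m : ℕ} (h : m ∣ (p - 1).factorial) :
    (m : F) ≠ 0 := by
  rw [Ne, CharP.cast_eq_zero_iff F p]
  intro h2
  have := (hp.dvd_factorial).1 (h2.trans h)
  have := hp.pos
  omega

theorem neZero_ofNat_of_lt (hp : p.Prime) {m : ℕ} (h0 : 0 < m) (h : m < p) : NeZero (m : F) :=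
  ⟨natCast_ne_zero_of_dvd_factorial F hp (Nat.dvd_factorial h0 (by omega))⟩

omit [CharP F p] [Field F] in
theorem five_le_of_prime (hp : p.Prime) (hp3 : 3 < p) : 5 ≤ p := by
  by_contra h
  interval_cases p
  revert hp
  decide

theorem inducesEven_alternatingGroup : InducesEven (alternatingGroup X) X :=
  fun σ hσ => ⟨⟨σ, hσ⟩, fun _ => rfl⟩

theorem natCast_card_stabilizer_alternatingGroup_ne_zero (hp : p.Prime) (hp3 : 3 < p) :
    (Nat.card (MulAction.stabilizer (alternatingGroup (Fin p)) (⟨0, hp.pos⟩ : Fin p)) : F) ≠ 0 := by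
  have := inducesEven_alternatingGroup.isPretransitive (X := Fin p)
    (by simpa using five_le_of_prime hp hp3)
  refine natCast_ne_zero_of_dvd_factorial F hp (Dvd.intro 2 ?_)
  have h1 := Subgroup.card_mul_index
    (MulAction.stabilizer (alternatingGroup (Fin p)) (⟨0, hp.pos⟩ : Fin p))
  rw [MulAction.index_stabilizer_of_transitive, Nat.card_fin] at h1
  have : Nontrivial (Fin p) := Fin.nontrivial_iff_two_le.2 (by omega)
  have h2 := two_mul_nat_card_alternatingGroup (α := Fin p)
  rw [Nat.card_perm, Nat.card_fin, ← h1, ← Nat.mul_factorial_pred hp.pos.ne'] at h2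
  refine Nat.eq_of_mul_eq_mul_left hp.pos ?_
  linarith

theorem weakBound_alternatingGroup_prime (hp : p.Prime) (hp3 : 3 < p) :
    WeakBound F (alternatingGroup (Fin p)) (p - 2) := by
  have hp5 := five_le_of_prime hp hp3
  have : NeZero (2 : F) := neZero_ofNat_of_lt F hp (m := 2) (by omega) (by omega)
  have : NeZero (3 : F) := neZero_ofNat_of_lt F hp (m := 3) (by omega) (by omega)
  have h6 : p ≠ 6 := by
    rintro rfl
    revert hp
    decide
  simpa using inducesEven_alternatingGroup.weakBound (F := F) (by simpa) (by simpa)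
    (natCast_card_stabilizer_alternatingGroup_ne_zero F hp hp3)

theorem strongBound_perm_prime (hp : p.Prime) (hp3 : 3 < p) :
    StrongBound F (Equiv.Perm (Fin p)) (p - 2) := by
  have hp5 := five_le_of_prime hp hp3
  have : NeZero (2 : F) := neZero_ofNat_of_lt F hp (m := 2) (by omega) (by omega)
  have := inducesEven_perm.isPretransitive (X := Fin p) (by simpa)
  have := strongBound_perm_of_card_stabilizer (F := F) (X := Fin p) (by simpa)
    (x := ⟨0, hp.pos⟩) (by
    refine natCast_ne_zero_of_dvd_factorial F hp (dvd_of_eq ?_)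
    have h1 := Subgroup.card_mul_index
      (MulAction.stabilizer (Equiv.Perm (Fin p)) (⟨0, hp.pos⟩ : Fin p))
    rw [MulAction.index_stabilizer_of_transitive, Nat.card_perm, Nat.card_fin,
      ← Nat.mul_factorial_pred hp.pos.ne'] at h1
    refine Nat.eq_of_mul_eq_mul_left hp.pos ?_
    linarith)
  simpa using this

end PrimeDegree

section Products

variable {F A B G Q : Type} [Field F] [Group A] [Group B] [Group G] [Group Q] {d : ℕ}
  {M : Type} [AddCommGroup M] [Module F M] [FiniteDimensional F M]

omit [FiniteDimensional F M] in
theorem hdim_comp_subtype (f : A →* G) (hf : Function.Injective f) {S : Subgroup G}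
    (h : f.range = S) (ρ : Representation F G M) (n : ℕ) :
    hdim n (ρ.comp S.subtype) = hdim n (ρ.comp f) := by
  subst h
  rw [← hdim_comp_equiv (MonoidHom.ofInjective hf)]
  rfl

theorem MonoidHom.range_inr_eq_ker_fst : (MonoidHom.inr A B).range = (MonoidHom.fst A B).ker := by
  ext ⟨a, b⟩
  exact ⟨by rintro ⟨c, hc⟩; exact (congrArg Prod.fst hc).symm, fun h => ⟨b, Prod.ext h.symm rfl⟩⟩

theorem MonoidHom.range_inl_eq_ker_snd : (MonoidHom.inl A B).range = (MonoidHom.snd A B).ker := by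
  ext ⟨a, b⟩
  exact ⟨by rintro ⟨c, hc⟩; exact (congrArg Prod.snd hc).symm, fun h => ⟨a, Prod.ext rfl h.symm⟩⟩

theorem WeakBound.mul_hdim_le_idim_comp_inr [Finite A] [Finite B] (hA : WeakBound F A d)
    (hB : (Nat.card B : F) ≠ 0) (σ : Representation F (A × B) M) :
    d * hdim 1 σ ≤ idim (σ.comp (MonoidHom.inr A B)) ∧
      d * hdim 2 σ ≤ idim (σ.comp (MonoidHom.inr A B)) := by
  let e := QuotientGroup.quotientKerEquivOfSurjective (MonoidHom.fst A B) Prod.fst_surjective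
  have hi : Function.Injective (MonoidHom.inr A B) := fun x y h => congrArg Prod.snd h
  have hN : Nat.card (MonoidHom.fst A B).ker = Nat.card B :=
    (Nat.card_congr ((MonoidHom.ofInjective hi).trans
      (MulEquiv.subgroupCongr MonoidHom.range_inr_eq_ker_fst)).toEquiv).symm
  obtain ⟨h1, h2⟩ := hdim_le_quotientToInvariants σ (MonoidHom.fst A B).ker (by rwa [hN])
  have a1 := (hA.1.of_equiv e.symm) _ (σ.quotientToInvariants (MonoidHom.fst A B).ker)
  have a2 := (hA.2.of_equiv e.symm) _ (σ.quotientToInvariants (MonoidHom.fst A B).ker)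
  have h0 := hdim_comp_subtype _ hi MonoidHom.range_inr_eq_ker_fst σ 0
  rw [hdim_zero, hdim_zero] at h0
  change _ ≤ idim (σ.comp (MonoidHom.fst A B).ker.subtype) at a1 a2
  have h1 := Nat.mul_le_mul_left d h1
  have h2 := Nat.mul_le_mul_left d h2
  omega

theorem two_mul_idim_comp_subtype_le (ρ : Representation F G M) (L : Subgroup G) (b : G)
    (hL : ∀ K : Subgroup G, L ≤ K → (∀ l ∈ L, b * l * b⁻¹ ∈ K) → K = ⊤) (h0 : idim ρ = 0) :
    2 * idim (ρ.comp L.subtype) ≤ finrank F M := by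
  set P := Representation.invariants (ρ.comp L.subtype) with hP
  have hinj : Function.Injective (ρ b) := fun x y h => by
    simpa using congrArg (ρ b⁻¹) h
  have h1 : finrank F (P.map (ρ b)) = finrank F P :=
    (LinearEquiv.finrank_eq (Submodule.equivMapOfInjective _ hinj P)).symm
  have h2 : P ⊓ P.map (ρ b) = ⊥ := by
    rw [Submodule.eq_bot_iff]
    rintro x ⟨hx, y, hy, hxy⟩
    let K : Subgroup G :=
      { carrier := {g | ρ g x = x}
        mul_mem' := fun {g h} hg hh => by
          change ρ (g * h) x = x
          rw [map_mul, Module.End.mul_apply, hh, hg]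
        one_mem' := by simp
        inv_mem' := fun {g} hg => by
          change ρ g⁻¹ x = x
          nth_rewrite 1 [← (hg : ρ g x = x)]
          simp }
    have hK := hL K (fun l hl => hx ⟨l, hl⟩) (fun l hl => by
      change ρ (b * l * b⁻¹) x = x
      have hy' : ρ l y = y := hy ⟨l, hl⟩
      rw [← hxy, map_mul, map_mul, Module.End.mul_apply, Module.End.mul_apply]
      simp [hy'])
    have hx' : x ∈ ρ.invariants := fun g => (hK ▸ Subgroup.mem_top g : g ∈ K)
    rw [Submodule.finrank_eq_zero.1 h0] at hx'
    exact (Submodule.mem_bot F).1 hx'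
  have h3 := Submodule.finrank_sup_add_finrank_inf_eq P (P.map (ρ b))
  rw [h2, finrank_bot, h1] at h3
  have h4 := Submodule.finrank_le (P ⊔ P.map (ρ b))
  change 2 * finrank F P ≤ _
  omega

theorem bounds_of_idim_eq_zero [Finite A] [Finite B] (hA : WeakBound F A d)
    (hB : WeakBound F B d) (hd : 3 ≤ d) (L : Subgroup B) (b : B) (hcard : (Nat.card L : F) ≠ 0)
    (hL : ∀ K : Subgroup B, L ≤ K → (∀ l ∈ L, b * l * b⁻¹ ∈ K) → K = ⊤)
    (ρ : Representation F (A × B) M) (h0A : idim (ρ.comp (MonoidHom.inl A B)) = 0)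
    (h0B : idim (ρ.comp (MonoidHom.inr A B)) = 0) :
    d * hdim 1 ρ ≤ finrank F M ∧ hdim 1 ρ + d * hdim 2 ρ ≤ finrank F M := by
  let S := (MonoidHom.snd A B).ker
  let R := L.comap (MonoidHom.snd A B)
  have hSR : S ≤ R := fun x hx => by
    change x.2 ∈ L
    rw [show x.2 = 1 from hx]
    exact L.one_mem
  let f : A × L →* A × B := MonoidHom.prodMap (MonoidHom.id A) L.subtype
  have hf : Function.Injective f := Function.Injective.prodMap Function.injective_id
    Subtype.val_injective
  have hfR : f.range = R := by
    ext ⟨x, y⟩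
    constructor
    · rintro ⟨⟨x', y'⟩, h⟩
      have : (y' : B) = y := congrArg Prod.snd h
      change y ∈ L
      rw [← this]
      exact y'.2
    · intro h
      exact ⟨(x, ⟨y, h⟩), rfl⟩
  have hS (n : ℕ) := hdim_comp_subtype _ (fun x y h => congrArg Prod.fst h)
    (MonoidHom.range_inl_eq_ker_snd (A := A) (B := B)) ρ n
  have hS0 : idim (ρ.comp S.subtype) = 0 := by rw [← hdim_zero, hS, hdim_zero, h0A]
  have : Subsingleton (Representation.invariants (ρ.comp S.subtype)) :=
    finrank_zero_iff.1 hS0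
  have hq (n : ℕ) : hdim (n + 1) (ρ.quotientToInvariants S) = 0 :=
    hdim_succ_eq_zero _ 0 (fun m => Subsingleton.elim _ _) n
  have hR := hA.mul_hdim_le_idim_comp_inr hcard (ρ.comp f)
  have hl := two_mul_idim_comp_subtype_le (ρ.comp (MonoidHom.inr A B)) L b hL h0B
  change 2 * idim ((ρ.comp f).comp (MonoidHom.inr A L)) ≤ _ at hl
  rw [← hdim_comp_subtype f hf hfR, ← hdim_comp_subtype f hf hfR] at hR
  have h1 := hdim_one_le_infRes ρ S R hSR
  obtain ⟨W, _, _, _, τ, hW, -, h2⟩ := exists_quotient_bound ρ S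
  have h2 := h2 R hSR
  rw [hq] at h1 h2
  rw [hS] at hW
  let e := QuotientGroup.quotientKerEquivOfSurjective (MonoidHom.snd A B) Prod.snd_surjective
  have hτ := hB.1.of_equiv e.symm W τ
  have hw := hA.1 M (ρ.comp (MonoidHom.inl A B))
  rw [← hW] at hw
  have k1 := Nat.mul_le_mul_left d h1
  have k2 := Nat.mul_le_mul_left d h2
  have k3 : 3 * hdim 1 ρ ≤ d * hdim 1 ρ := Nat.mul_le_mul_right _ hd
  have k4 : 3 * finrank F W ≤ d * finrank F W := Nat.mul_le_mul_right _ hd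
  simp only [Nat.mul_add] at k1 k2
  constructor <;> omega

end Products

section Irreducible

variable {F A B G : Type} [Field F] [Group A] [Group B] [Group G] [Finite G] {b c d : ℕ}

theorem CohBound.of_forall_subrepresentation
    (h : ∀ (M : Type) [AddCommGroup M] [Module F M] [FiniteDimensional F M]
      (ρ : Representation F G M),
      (∀ W : Subrepresentation ρ, W.toSubmodule = ⊥ ∨ W.toSubmodule = ⊤) →
        idim ρ + b * hdim 1 ρ + c * hdim 2 ρ ≤ finrank F M) : CohBound F G b c := by
  intro M _ _ _ ρ
  induction hn : finrank F M using Nat.strong_induction_on generalizing M with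
  | _ n ih =>
    subst hn
    by_cases hW : ∀ W : Subrepresentation ρ, W.toSubmodule = ⊥ ∨ W.toSubmodule = ⊤
    · exact h M ρ hW
    push Not at hW
    obtain ⟨W, hbot, htop⟩ := hW
    have ses := isSES_sub W
    have hlt : finrank F W.toSubmodule < finrank F M := Submodule.finrank_lt htop
    have hpos : 0 < finrank F W.toSubmodule :=
      Nat.pos_of_ne_zero fun h0 => hbot (Submodule.finrank_eq_zero.1 h0)
    have hadd := Submodule.finrank_quotient_add_finrank W.toSubmodule
    have i1 := ih _ hlt W.toSubmodule W.toRepresentation rfl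
    have i2 := ih _ (by omega) (M ⧸ W.toSubmodule) (subQuot W) rfl
    have h0 := ses.idim_le
    have h1 := Nat.mul_le_mul_left b (ses.hdim_le 1)
    have h2 := Nat.mul_le_mul_left c (ses.hdim_le 2)
    simp only [Nat.mul_add] at h1 h2
    omega

theorem CohBound.le_of_invariants_eq_top {M : Type} [AddCommGroup M] [Module F M]
    [FiniteDimensional F M] (ρ : Representation F G M) (N : Subgroup G) [N.Normal]
    (hN : WeakBound F N d) (hd : 0 < d) (hQ : CohBound F (G ⧸ N) b c)
    (h : Representation.invariants (ρ.comp N.subtype) = ⊤) :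
    idim ρ + b * hdim 1 ρ + c * hdim 2 ρ ≤ finrank F M := by
  have h0 : idim (ρ.comp N.subtype) = finrank F M := by
    rw [← finrank_top F M, ← h]
    rfl
  have a1 := hN.1 M (ρ.comp N.subtype)
  have a2 := hN.2 M (ρ.comp N.subtype)
  have z1 : hdim 1 (ρ.comp N.subtype) = 0 := by
    rcases Nat.eq_zero_or_pos (hdim 1 (ρ.comp N.subtype)) with h | h
    · exact h
    · have := Nat.mul_pos hd h
      omega
  have z2 : hdim 2 (ρ.comp N.subtype) = 0 := by
    rcases Nat.eq_zero_or_pos (hdim 2 (ρ.comp N.subtype)) with h | h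
    · exact h
    · have := Nat.mul_pos hd h
      omega
  obtain ⟨W, _, _, _, τ, hW, h1, h2⟩ := exists_quotient_bound ρ N
  have h2 := h2 N le_rfl
  rw [z1] at hW
  have : Subsingleton W := finrank_zero_iff.1 hW
  have t0 := idim_le_finrank τ
  have t1 : hdim 1 τ = 0 := hdim_succ_eq_zero τ 0 (fun m => Subsingleton.elim _ _) 0
  have hq := hQ _ (ρ.quotientToInvariants N)
  rw [idim_quotientToInvariants] at hq
  have k1 := Nat.mul_le_mul_left b (show hdim 1 ρ ≤ hdim 1 (ρ.quotientToInvariants N) by omega)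
  have k2 := Nat.mul_le_mul_left c (show hdim 2 ρ ≤ hdim 2 (ρ.quotientToInvariants N) by omega)
  change _ ≤ idim (ρ.comp N.subtype) at hq
  omega

/-- The vectors fixed by a normal subgroup, as a subrepresentation. -/
noncomputable def invariantsSubrepresentation {M : Type} [AddCommGroup M] [Module F M]
    (ρ : Representation F G M) (N : Subgroup G) [N.Normal] : Subrepresentation ρ where
  toSubmodule := Representation.invariants (ρ.comp N.subtype)
  apply_mem_toSubmodule g _ hv := Representation.le_comap_invariants ρ N g hv

theorem StrongBound.of_prod [Finite A] [Finite B] (f : A × B →* G) (hf : Function.Injective f)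
    (hi : (f.range.index : F) ≠ 0) (N₁ N₂ : Subgroup G) [N₁.Normal] [N₂.Normal]
    (h₁ : (f.comp (MonoidHom.inl A B)).range = N₁) (h₂ : (f.comp (MonoidHom.inr A B)).range = N₂)
    (hA : WeakBound F A d) (hB : WeakBound F B d) (hd : 3 ≤ d) (L : Subgroup B) (b : B)
    (hcard : (Nat.card L : F) ≠ 0)
    (hL : ∀ K : Subgroup B, L ≤ K → (∀ l ∈ L, b * l * b⁻¹ ∈ K) → K = ⊤)
    (hQ₁ : StrongBound F (G ⧸ N₁) d) (hQ₂ : StrongBound F (G ⧸ N₂) d) : StrongBound F G d := by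
  have i₁ : Function.Injective (f.comp (MonoidHom.inl A B)) :=
    hf.comp fun x y h => congrArg Prod.fst h
  have i₂ : Function.Injective (f.comp (MonoidHom.inr A B)) :=
    hf.comp fun x y h => congrArg Prod.snd h
  have e₁ : A ≃* N₁ := (MonoidHom.ofInjective i₁).trans (MulEquiv.subgroupCongr h₁)
  have e₂ : B ≃* N₂ := (MonoidHom.ofInjective i₂).trans (MulEquiv.subgroupCongr h₂)
  have hN₁ : WeakBound F N₁ d := ⟨hA.1.of_equiv e₁, hA.2.of_equiv e₁⟩
  have hN₂ : WeakBound F N₂ d := ⟨hB.1.of_equiv e₂, hB.2.of_equiv e₂⟩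
  have key (M : Type) [AddCommGroup M] [Module F M] [FiniteDimensional F M]
      (ρ : Representation F G M)
      (hW : ∀ W : Subrepresentation ρ, W.toSubmodule = ⊥ ∨ W.toSubmodule = ⊤) :
      idim ρ + d * hdim 1 ρ + 0 * hdim 2 ρ ≤ finrank F M ∧
        idim ρ + 1 * hdim 1 ρ + d * hdim 2 ρ ≤ finrank F M := by
    rcases hW (invariantsSubrepresentation ρ N₁) with w₁ | w₁
    · rcases hW (invariantsSubrepresentation ρ N₂) with w₂ | w₂
      · have z₁ : idim ((ρ.comp f).comp (MonoidHom.inl A B)) = 0 := by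
          rw [← hdim_zero]
          refine (hdim_comp_subtype _ i₁ h₁ ρ 0).symm.trans ?_
          rw [hdim_zero]
          exact Submodule.finrank_eq_zero.2 w₁
        have z₂ : idim ((ρ.comp f).comp (MonoidHom.inr A B)) = 0 := by
          rw [← hdim_zero]
          refine (hdim_comp_subtype _ i₂ h₂ ρ 0).symm.trans ?_
          rw [hdim_zero]
          exact Submodule.finrank_eq_zero.2 w₂
        have z : idim ρ = 0 := by
          refine Submodule.finrank_eq_zero.2 (eq_bot_iff.2 ?_)
          exact le_trans (b := Representation.invariants (ρ.comp N₁.subtype))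
            (fun v hv g => hv g) w₁.le
        obtain ⟨k1, k2⟩ := bounds_of_idim_eq_zero hA hB hd L b hcard hL (ρ.comp f) z₁ z₂
        have l1 := hdim_le_of_injective f hf hi ρ 1
        have l1d := Nat.mul_le_mul_left d l1
        have l2 := Nat.mul_le_mul_left d (hdim_le_of_injective f hf hi ρ 2)
        omega
      · exact ⟨hQ₂.1.le_of_invariants_eq_top ρ N₂ hN₂ (by omega) w₂,
          hQ₂.2.le_of_invariants_eq_top ρ N₂ hN₂ (by omega) w₂⟩
    · exact ⟨hQ₁.1.le_of_invariants_eq_top ρ N₁ hN₁ (by omega) w₁,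
        hQ₁.2.le_of_invariants_eq_top ρ N₁ hN₁ (by omega) w₁⟩
  exact ⟨.of_forall_subrepresentation fun M _ _ _ ρ hW => (key M ρ hW).1,
    .of_forall_subrepresentation fun M _ _ _ ρ hW => (key M ρ hW).2⟩

end Irreducible

section EvenTuples

/-- The product of the signs of a tuple of permutations. -/
def signProd (k p : ℕ) : (Fin k → Equiv.Perm (Fin p)) →* ℤˣ where
  toFun x := ∏ i, Equiv.Perm.sign (x i)
  map_one' := by simp
  map_mul' x y := by simp [Finset.prod_mul_distrib]

/-- The tuples of permutations inducing an even permutation of the disjoint union. -/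
abbrev evenTuples (k p : ℕ) : Subgroup (Fin k → Equiv.Perm (Fin p)) := (signProd k p).ker

theorem mem_evenTuples {k p : ℕ} {x : Fin k → Equiv.Perm (Fin p)} :
    x ∈ evenTuples k p ↔ ∏ i, Equiv.Perm.sign (x i) = 1 := Iff.rfl

/-- The projection of a tuple to one of its entries. -/
def evenTuplesEval {k p : ℕ} (i : Fin k) : evenTuples k p →* Equiv.Perm (Fin p) :=
  (Pi.evalMonoidHom _ i).comp (evenTuples k p).subtype

theorem signProd_mulSingle {k p : ℕ} (i : Fin k) (σ : Equiv.Perm (Fin p)) :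
    signProd k p (Pi.mulSingle i σ) = Equiv.Perm.sign σ := by
  change ∏ j, Equiv.Perm.sign ((Pi.mulSingle i σ : Fin k → Equiv.Perm (Fin p)) j) = _
  rw [Finset.prod_eq_single i]
  · rw [Pi.mulSingle_eq_same]
  · intro j _ hj
    rw [Pi.mulSingle_eq_of_ne hj, map_one]
  · simp

theorem evenTuplesEval_surjective {k p : ℕ} {i j : Fin k} (hij : i ≠ j) :
    Function.Surjective (evenTuplesEval (p := p) i) := by
  intro σ
  refine ⟨⟨Pi.mulSingle i σ * Pi.mulSingle j σ, ?_⟩, ?_⟩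
  · rw [MonoidHom.mem_ker, map_mul, signProd_mulSingle, signProd_mulSingle, Int.units_mul_self]
  · change (Pi.mulSingle i σ : Fin k → Equiv.Perm (Fin p)) i *
      (Pi.mulSingle j σ : Fin k → Equiv.Perm (Fin p)) i = σ
    rw [Pi.mulSingle_eq_same, Pi.mulSingle_eq_of_ne hij, mul_one]

/-- Adding a trivial first entry. -/
def evenTuplesCons (k p : ℕ) : evenTuples k p →* evenTuples (k + 1) p where
  toFun x := ⟨Fin.cons 1 x.1, by
    rw [mem_evenTuples, Fin.prod_univ_succ]
    simpa using mem_evenTuples.1 x.2⟩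
  map_one' := by
    ext i : 2
    refine Fin.cases ?_ (fun j => ?_) i <;> rfl
  map_mul' x y := by
    ext i : 2
    refine Fin.cases ?_ (fun j => ?_) i <;> simp

theorem evenTuplesCons_injective (k p : ℕ) : Function.Injective (evenTuplesCons k p) := by
  intro x y h
  exact Subtype.ext (funext fun i => congrFun (congrArg Subtype.val h) i.succ)

theorem range_evenTuplesCons (k p : ℕ) :
    (evenTuplesCons k p).range = (evenTuplesEval (p := p) (0 : Fin (k + 1))).ker := by
  ext x
  constructor
  · rintro ⟨y, rfl⟩
    rfl
  · intro h
    have h0 : x.1 0 = 1 := h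
    have hx := x.2
    rw [mem_evenTuples, Fin.prod_univ_succ, h0, map_one, one_mul] at hx
    refine ⟨⟨fun i => x.1 i.succ, hx⟩, ?_⟩
    ext i : 2
    refine Fin.cases ?_ (fun j => ?_) i
    · exact h0.symm
    · rfl

/-- Pairs of even permutations, as even tuples. -/
def evenPairs (p : ℕ) :
    alternatingGroup (Fin p) × alternatingGroup (Fin p) →* evenTuples 2 p where
  toFun x := ⟨![x.1.1, x.2.1], by
    rw [mem_evenTuples, Fin.prod_univ_two]
    exact (congrArg₂ (· * ·) x.1.2 x.2.2).trans (mul_one 1)⟩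
  map_one' := by
    ext i : 2
    fin_cases i <;> rfl
  map_mul' x y := by
    ext i : 2
    fin_cases i <;> rfl

theorem evenPairs_injective (p : ℕ) : Function.Injective (evenPairs p) := by
  intro x y h
  have h := congrArg Subtype.val h
  exact Prod.ext (Subtype.ext (congrFun h 0)) (Subtype.ext (congrFun h 1))

theorem range_evenPairs (p : ℕ) :
    (evenPairs p).range = (Equiv.Perm.sign.comp (evenTuplesEval (p := p) (0 : Fin 2))).ker := by
  ext x
  constructor
  · rintro ⟨y, rfl⟩
    exact y.1.2
  · intro h
    have h0 : Equiv.Perm.sign (x.1 0) = 1 := h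
    have hx := x.2
    rw [mem_evenTuples, Fin.prod_univ_two, h0, one_mul] at hx
    refine ⟨⟨⟨x.1 0, h0⟩, ⟨x.1 1, hx⟩⟩, ?_⟩
    ext i : 2
    fin_cases i <;> rfl

theorem range_evenPairs_inl (p : ℕ) :
    ((evenPairs p).comp (MonoidHom.inl _ _)).range = (evenTuplesEval (p := p) (1 : Fin 2)).ker := by
  ext x
  constructor
  · rintro ⟨y, rfl⟩
    rfl
  · intro h
    have h1 : x.1 1 = 1 := h
    have hx := x.2
    rw [mem_evenTuples, Fin.prod_univ_two, h1, map_one, mul_one] at hx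
    refine ⟨⟨x.1 0, hx⟩, ?_⟩
    ext i : 2
    fin_cases i
    · rfl
    · exact h1.symm

theorem range_evenPairs_inr (p : ℕ) :
    ((evenPairs p).comp (MonoidHom.inr _ _)).range = (evenTuplesEval (p := p) (0 : Fin 2)).ker := by
  ext x
  constructor
  · rintro ⟨y, rfl⟩
    rfl
  · intro h
    have h0 : x.1 0 = 1 := h
    have hx := x.2
    rw [mem_evenTuples, Fin.prod_univ_two, h0, map_one, one_mul] at hx
    refine ⟨⟨x.1 1, hx⟩, ?_⟩
    ext i : 2
    fin_cases i
    · exact h0.symm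
    · rfl

end EvenTuples

section StrongBoundEvenTuples

theorem stabilizer_and_conj_generate {G X : Type} [Group G] [MulAction G X] [Fintype X]
    [DecidableEq X] (hG : InducesEven G X) (hX : 5 ≤ Fintype.card X) {x y : X} (hxy : x ≠ y) {b : G}
    (hb : b • y = x) (K : Subgroup G) (hK : MulAction.stabilizer G x ≤ K)
    (hbK : ∀ l ∈ MulAction.stabilizer G x, b * l * b⁻¹ ∈ K) : K = ⊤ := by
  have : MulAction.IsPreprimitive G X := by
    refine MulAction.isPreprimitive_of_is_two_pretransitive
      (MulAction.is_two_pretransitive_iff.2 fun {a c u v} hac huv => ?_)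
    obtain ⟨d, hd⟩ := exists_notMem_of_card_lt {a, c} (Finset.card_le_two.trans_lt (by omega))
    obtain ⟨w, hw⟩ := exists_notMem_of_card_lt {u, v} (Finset.card_le_two.trans_lt (by omega))
    simp only [Finset.mem_insert, Finset.mem_singleton, not_or] at hd hw
    obtain ⟨g, h1, h2, -⟩ := hG.exists_smul_three hX hac (Ne.symm hd.1) (Ne.symm hd.2) huv
      (Ne.symm hw.1) (Ne.symm hw.2)
    exact ⟨g, h1, h2⟩
  have : Nontrivial X := ⟨x, y, hxy⟩
  refine ((MulAction.IsPreprimitive.isCoatom_stabilizer_of_isPreprimitive G x).le_iff.1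
    hK).resolve_right ?_
  rintro rfl
  obtain ⟨z, hz⟩ := exists_notMem_of_card_lt {x, y} (Finset.card_le_two.trans_lt (by omega))
  simp only [Finset.mem_insert, Finset.mem_singleton, not_or] at hz
  obtain ⟨l, hlx, hly, -⟩ := hG.exists_smul_three hX hxy (Ne.symm hz.1) (Ne.symm hz.2)
    (Ne.symm hz.1) hxy hz.2
  have h := hbK l hlx
  rw [MulAction.mem_stabilizer_iff, mul_smul, mul_smul, ← hb, inv_smul_smul, hly,
    smul_left_cancel_iff] at h
  exact hz.2 h

variable (F : Type) [Field F] {p : ℕ} [CharP F p]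

theorem strongBound_quotient_ker_evenTuplesEval (hp : p.Prime) (hp3 : 3 < p) {k : ℕ} {i j : Fin k}
    (hij : i ≠ j) : StrongBound F (evenTuples k p ⧸ (evenTuplesEval (p := p) i).ker) (p - 2) := by
  have e := (QuotientGroup.quotientKerEquivOfSurjective _
    (evenTuplesEval_surjective (p := p) hij)).symm
  have h := strongBound_perm_prime F hp hp3
  exact ⟨h.1.of_equiv e, h.2.of_equiv e⟩

theorem strongBound_evenTuples_two (hp : p.Prime) (hp3 : 3 < p) :
    StrongBound F (evenTuples 2 p) (p - 2) := by
  have hp5 := five_le_of_prime hp hp3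
  have hG := inducesEven_alternatingGroup (X := Fin p)
  have hX : 5 ≤ Fintype.card (Fin p) := by simpa
  have := hG.isPretransitive hX
  have h01 : (⟨0, hp.pos⟩ : Fin p) ≠ ⟨1, hp.one_lt⟩ := by simp
  obtain ⟨b, hb⟩ := MulAction.exists_smul_eq (alternatingGroup (Fin p))
    (⟨1, hp.one_lt⟩ : Fin p) ⟨0, hp.pos⟩
  refine StrongBound.of_prod (evenPairs p) (evenPairs_injective p) ?_ _ _ (range_evenPairs_inl p)
    (range_evenPairs_inr p) (weakBound_alternatingGroup_prime F hp hp3)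
    (weakBound_alternatingGroup_prime F hp hp3) (by omega) _ b
    (natCast_card_stabilizer_alternatingGroup_ne_zero F hp hp3)
    (stabilizer_and_conj_generate hG hX h01 hb)
    (strongBound_quotient_ker_evenTuplesEval F hp hp3 (by decide : (1 : Fin 2) ≠ 0))
    (strongBound_quotient_ker_evenTuplesEval F hp hp3 (by decide : (0 : Fin 2) ≠ 1))
  rw [range_evenPairs, Subgroup.index_ker]
  refine natCast_ne_zero_of_dvd_factorial F hp ((Subgroup.card_subgroup_dvd_card _).trans ?_)
  rw [Nat.card_eq_fintype_card, Fintype.card_units_int]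
  exact Nat.dvd_factorial two_pos (by omega)

theorem strongBound_evenTuples (hp : p.Prime) (hp3 : 3 < p) {k : ℕ} (hk : 2 ≤ k) :
    StrongBound F (evenTuples k p) (p - 2) := by
  induction k, hk using Nat.le_induction with
  | base => exact strongBound_evenTuples_two F hp hp3
  | succ k hk ih =>
    have : NeZero k := ⟨by omega⟩
    exact StrongBound.extension (evenTuplesCons k p) (evenTuplesCons_injective k p)
      (evenTuplesEval 0) (evenTuplesEval_surjective (j := Fin.last k) (Fin.last_pos'.ne))
      (range_evenTuplesCons k p) (strongBound_perm_prime F hp hp3) ih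

end StrongBoundEvenTuples

section Embedding

theorem not_dvd_factor_of_mul_factorial {p k n i a : ℕ} (hp : p.Prime)
    (hk : k = n / p) (h : a * i = n.factorial) {c : ℕ} (hpc : ¬ p ∣ c)
    (hc : c * a = p.factorial ^ k * k.factorial) :    ¬ p ∣ i := by
  have := Fact.mk hp
  intro hi
  have hn := Nat.factorial_ne_zero n
  have hi0 : i ≠ 0 := by rintro rfl; simp [← h] at hn
  have ha0 : a ≠ 0 := by rintro rfl; simp [← h] at hn
  have hpk := pow_ne_zero k (Nat.factorial_ne_zero p)
  have hc0 : c ≠ 0 := by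
    rintro rfl
    rw [zero_mul] at hc
    exact mul_ne_zero hpk k.factorial_ne_zero hc.symm
  have h1 := congrArg (padicValNat p) h
  have h2 := congrArg (padicValNat p) hc
  have h3 := padicValNat_factorial_mul (p := p) 1
  rw [padicValNat.mul ha0 hi0, ← padicValNat_mul_div_factorial, ← hk,
    padicValNat_factorial_mul] at h1
  rw [padicValNat.mul hc0 ha0, padicValNat.mul hpk k.factorial_ne_zero, padicValNat.pow] at h2
  rw [mul_one] at h3
  simp only [Nat.factorial_one, padicValNat_one_right, zero_add] at h3
  rw [h3, mul_one] at h2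
  have := padicValNat.eq_zero_of_not_dvd hpc
  have := one_le_padicValNat_of_dvd hi0 hi
  omega

/-- The embedding into an alternating group given by an even action on a subset. -/
noncomputable def evenEmbedding {G Y : Type} [Group G] [Fintype Y] [DecidableEq Y] {n : ℕ}
    (f : G →* Equiv.Perm Y) (hs : ∀ g, Equiv.Perm.sign (f g) = 1) (e : Y ↪ Fin n) :
    G →* alternatingGroup (Fin n) :=
  ((Equiv.Perm.viaEmbeddingHom e).comp f).codRestrict _ fun g => by
    rw [Equiv.Perm.mem_alternatingGroup, ← hs g, MonoidHom.comp_apply,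
      Equiv.Perm.viaEmbeddingHom_apply, Equiv.Perm.viaEmbedding]
    convert Equiv.Perm.sign_extendDomain (f g) (Equiv.ofInjective e.1 e.2)

theorem WeakBound.alternatingGroup_of_embedding {F G Y : Type} [Field F] [Group G] [Fintype Y]
    [DecidableEq Y] {d n p k c : ℕ} [CharP F p] (hG : WeakBound F G d) (f : G →* Equiv.Perm Y)
    (hf : Function.Injective f) (hs : ∀ g, Equiv.Perm.sign (f g) = 1) (e : Y ↪ Fin n)
    (hp : p.Prime) (hn : 2 ≤ n) (hk : k = n / p)
    (hpc : ¬ p ∣ c)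
    (hc : c * Nat.card G = p.factorial ^ k * k.factorial) :
    WeakBound F (alternatingGroup (Fin n)) d := by
  have hf' : Function.Injective (evenEmbedding f hs e) := fun a b h =>
    hf (Equiv.Perm.viaEmbeddingHom_injective e (congrArg Subtype.val h))
  have hi : ((evenEmbedding f hs e).range.index : F) ≠ 0 := by
    rw [Ne, CharP.cast_eq_zero_iff F p]
    refine fun h => not_dvd_factor_of_mul_factorial hp hk ?_ hpc hc (dvd_mul_of_dvd_right h 2)
    have : Nontrivial (Fin n) := Fin.nontrivial_iff_two_le.2 hn
    have h1 := Subgroup.card_mul_index (evenEmbedding f hs e).range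
    have h2 := two_mul_nat_card_alternatingGroup (α := Fin n)
    rw [Nat.card_perm, Nat.card_fin, ← h1,
      ← Nat.card_congr (MonoidHom.ofInjective hf').toEquiv] at h2
    linarith
  exact ⟨hG.1.of_injective _ hf' hi, hG.2.of_injective _ hf' hi⟩

end Embedding

section Wreath

variable (k p : ℕ)

/-- Permuting the entries of a tuple. -/
def evenTuplesPerm (σ : Equiv.Perm (Fin k)) : MulAut (evenTuples k p) where
  toFun x := ⟨fun i => x.1 (σ⁻¹ i), by
    rw [mem_evenTuples, Equiv.prod_comp σ⁻¹ fun i => Equiv.Perm.sign (x.1 i)]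
    exact x.2⟩
  invFun x := ⟨fun i => x.1 (σ i), by
    rw [mem_evenTuples, Equiv.prod_comp σ fun i => Equiv.Perm.sign (x.1 i)]
    exact x.2⟩
  left_inv x := by
    ext i : 2
    simp
  right_inv x := by
    ext i : 2
    simp
  map_mul' _ _ := rfl

/-- The action of the alternating group on tuples of permutations. -/
def evenTuplesAct : alternatingGroup (Fin k) →* MulAut (evenTuples k p) where
  toFun σ := evenTuplesPerm k p σ
  map_one' := rfl
  map_mul' _ _ := rfl

/-- The group of even tuples extended by the even permutations of the entries. -/
abbrev EvenWreath : Type := evenTuples k p ⋊[evenTuplesAct k p] alternatingGroup (Fin k)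

/-- Tuples of permutations act blockwise. -/
def evenTuplesToPerm : evenTuples k p →* Equiv.Perm (Fin k × Fin p) where
  toFun x := Equiv.prodCongrRight x.1
  map_one' := rfl
  map_mul' _ _ := rfl

/-- The alternating group acts by permuting the blocks. -/
def alternatingToPerm : alternatingGroup (Fin k) →* Equiv.Perm (Fin k × Fin p) where
  toFun σ := Equiv.prodCongrLeft fun _ => σ.1
  map_one' := rfl
  map_mul' _ _ := rfl

/-- The imprimitive action of `EvenWreath k p`. -/
def evenWreathToPerm : EvenWreath k p →* Equiv.Perm (Fin k × Fin p) :=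
  SemidirectProduct.lift (evenTuplesToPerm k p) (alternatingToPerm k p) fun σ => by
    refine MonoidHom.ext fun x => Equiv.ext fun a => Prod.ext ?_ ?_
    · change a.1 = σ.1 (σ.1⁻¹ a.1)
      simp
    · rfl

variable {k p}

theorem evenWreathToPerm_apply (g : EvenWreath k p) (i : Fin k) (a : Fin p) :
    evenWreathToPerm k p g (i, a) = (g.right.1 i, g.left.1 (g.right.1 i) a) := rfl

theorem evenWreathToPerm_injective (hp : 0 < p) :
    Function.Injective (evenWreathToPerm k p) := by
  intro g h hgh
  have H (i : Fin k) (a : Fin p) := congrFun (congrArg DFunLike.coe hgh) (i, a)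
  simp only [evenWreathToPerm_apply, Prod.mk.injEq] at H
  have hr : g.right = h.right := Subtype.ext (Equiv.ext fun i => (H i ⟨0, hp⟩).1)
  refine SemidirectProduct.ext (Subtype.ext (funext fun i => Equiv.ext fun a => ?_)) hr
  simpa [hr] using (H (h.right.1⁻¹ i) a).2

theorem sign_evenWreathToPerm (g : EvenWreath k p) :
    Equiv.Perm.sign (evenWreathToPerm k p g) = 1 := by
  change Equiv.Perm.sign (Equiv.prodCongrRight g.left.1 *
    Equiv.prodCongrLeft fun _ : Fin p => g.right.1) = 1
  rw [map_mul, Equiv.Perm.sign_prodCongrRight, Equiv.Perm.sign_prodCongrLeft,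
    mem_evenTuples.1 g.left.2, Equiv.Perm.mem_alternatingGroup.1 g.right.2]
  simp

theorem two_mul_card_evenTuples (hk : 0 < k) (hp : 2 ≤ p) :
    2 * Nat.card (evenTuples k p) = p.factorial ^ k := by
  have hs : Function.Surjective (signProd k p) := fun u => by
    have : Nontrivial (Fin p) := Fin.nontrivial_iff_two_le.2 hp
    obtain ⟨σ, rfl⟩ := Equiv.Perm.sign_surjective (Fin p) u
    exact ⟨_, signProd_mulSingle ⟨0, hk⟩ σ⟩
  have h := Subgroup.card_mul_index (evenTuples k p)
  rw [Subgroup.index_ker, MonoidHom.range_eq_top.2 hs, Subgroup.card_top,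
    Nat.card_eq_fintype_card (α := ℤˣ), Fintype.card_units_int] at h
  rw [mul_comm, h, Nat.card_fun, Nat.card_perm, Nat.card_fin, Nat.card_fin]

theorem four_mul_card_evenWreath (hk : 2 ≤ k) (hp : 2 ≤ p) :
    4 * Nat.card (EvenWreath k p) = p.factorial ^ k * k.factorial := by
  have : Nontrivial (Fin k) := Fin.nontrivial_iff_two_le.2 hk
  have h := two_mul_nat_card_alternatingGroup (α := Fin k)
  rw [Nat.card_perm, Nat.card_fin] at h
  rw [SemidirectProduct.card, ← two_mul_card_evenTuples (by omega) hp, ← h]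
  ring

end Wreath

section Main

theorem weakBound_alternatingGroup (F : Type) [Field F] {p : ℕ} [CharP F p] (hp : p.Prime)
    (hp3 : 3 < p) (n : ℕ) : WeakBound F (alternatingGroup (Fin n)) (p - 2) := by
  induction n using Nat.strong_induction_on with
  | h n ih =>
  rcases lt_or_ge n p with hnp | hnp
  · have hG : (Nat.card (alternatingGroup (Fin n)) : F) ≠ 0 := by
      refine natCast_ne_zero_of_dvd_factorial F hp ((Subgroup.card_subgroup_dvd_card _).trans ?_)
      rw [Nat.card_perm, Nat.card_fin]
      exact Nat.factorial_dvd_factorial (by omega)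
    exact ⟨cohBound_of_card hG _ _, cohBound_of_card hG _ _⟩
  obtain ⟨k, hk⟩ : ∃ k, k = n / p := ⟨_, rfl⟩
  have hk1 : 1 ≤ k := hk ▸ (Nat.one_le_div_iff hp.pos).2 hnp
  rcases hk1.eq_or_lt with rfl | hk2
  · refine (weakBound_alternatingGroup_prime F hp hp3).alternatingGroup_of_embedding
      (alternatingGroup (Fin p)).subtype Subtype.val_injective (fun g => g.2)
      (Fin.castLEEmb hnp) hp (by omega) hk (c := 2)
      (Nat.not_dvd_of_pos_of_lt two_pos (by omega)) ?_
    have : Nontrivial (Fin p) := Fin.nontrivial_iff_two_le.2 (by omega)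
    rw [two_mul_nat_card_alternatingGroup, Nat.card_perm, Nat.card_fin]
    simp
  · have hkn : k * p ≤ n := hk ▸ Nat.div_mul_le_self n p
    have hlt : k < n := hk ▸ Nat.div_lt_self (by omega) hp.one_lt
    obtain ⟨e⟩ : Nonempty (Fin k × Fin p ↪ Fin n) :=
      Function.Embedding.nonempty_of_card_le (by simpa)
    have : Finite (EvenWreath k p) := Finite.of_equiv _ SemidirectProduct.equivProd.symm
    have hG : WeakBound F (EvenWreath k p) (p - 2) :=
      WeakBound.extension SemidirectProduct.inl SemidirectProduct.inl_injective
        SemidirectProduct.rightHom SemidirectProduct.rightHom_surjective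
        SemidirectProduct.range_inl_eq_ker_rightHom (ih k hlt) (strongBound_evenTuples F hp hp3 hk2)
    exact hG.alternatingGroup_of_embedding (evenWreathToPerm k p)
      (evenWreathToPerm_injective hp.pos) sign_evenWreathToPerm e hp (by omega) hk
      (c := 4) (Nat.not_dvd_of_pos_of_lt four_pos (five_le_of_prime hp hp3))
      (four_mul_card_evenWreath hk2 hp.two_le)

end Main

end CohomologyBounds

/-- Let `p > 3` be prime, `n` a positive integer, `G = Aₙ`, `F` a field of characteristic
`p` and `M` a finite-dimensional `FG`-module.  Then for `j = 1, 2`,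
`(p-2) · dim Hʲ(G,M) ≤ dim M`. -/
theorem stmt_6 (p n : ℕ) (hp : p.Prime) (hp3 : 3 < p) (hn : 0 < n)
    (F : Type) [Field F] [CharP F p]
    (M : Type) [AddCommGroup M] [Module F M] [FiniteDimensional F M]
    (ρ : Representation F (alternatingGroup (Fin n)) M) :
    (p - 2) * Module.finrank F (groupCohomology (Rep.of ρ) 1) ≤ Module.finrank F M ∧
      (p - 2) * Module.finrank F (groupCohomology (Rep.of ρ) 2) ≤ Module.finrank F M := by
  obtain ⟨h1, h2⟩ := weakBound_alternatingGroup F hp hp3 n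
  have h1 := h1 M ρ
  have h2 := h2 M ρ
  simp only [hdim] at h1 h2
  omega
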